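/- arXiv:1004.0454 — 2 statements merged into one kernel-verified Lean document; each statement's English description precedes it below -/
import Mathlib

section
/- Let α₀ be a real quadratic irrational which is an algebraic integer, let 𝒪 = ℤ + α₀ℤ, let D = Tr(α₀)² − 4N(α₀), let (t₀, u₀) be the fundamental solution of the Pell equation t² − D u² = 4 (i.e. t₀, u₀ > 0 and u₀ minimal), let ε₀ = (t₀ + u₀√D)/2 and R₀ = log ε₀, and let n₀ = 2 if 𝒪 contains a unit of norm −1 and n₀ = 1 otherwise. Then, as t → +∞, the number of orbits under translation by ℤ of elements α of PSL₂(ℤ)·{α₀, α₀^σ} with |α − α^σ|^{−1} ≤ t is asymptotically equivalent to (24 R₀ / (π² n₀)) · t. -/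
open scoped Real

abbrev SL2Z := Matrix.SpecialLinearGroup (Fin 2) ℤ

/-- The action of `SL(2,ℤ)` (through `PSL(2,ℤ)`) on `ℝ` by Möbius transformations. -/
noncomputable def mobius (g : SL2Z) (x : ℝ) : ℝ :=
  ((g.1 0 0 : ℝ) * x + (g.1 0 1 : ℝ)) / ((g.1 1 0 : ℝ) * x + (g.1 1 1 : ℝ))

/-- The automorphy factor `c x + d` of the Möbius action. -/
noncomputable def mobiusDenom (g : SL2Z) (x : ℝ) : ℝ :=
  (g.1 1 0 : ℝ) * x + (g.1 1 1 : ℝ)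

lemma SL2Z_det (g : SL2Z) : g.1 0 0 * g.1 1 1 - g.1 0 1 * g.1 1 0 = 1 := by
  have h := g.2
  rwa [Matrix.det_fin_two] at h

lemma SL2Z_det_real (g : SL2Z) :
    (g.1 0 0 : ℝ) * g.1 1 1 - g.1 0 1 * g.1 1 0 = 1 := by
  exact_mod_cast SL2Z_det g

lemma eq_zero_of_irrational {x : ℝ} (hx : Irrational x) {c d : ℤ}
    (h : (c : ℝ) * x + d = 0) : c = 0 ∧ d = 0 := by
  have hc : c = 0 := by
    by_contra hc
    exact ((hx.intCast_mul hc).add_intCast d).ne_zero h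
  subst hc
  exact ⟨rfl, by simpa using h⟩

lemma coeffs_eq_of_irrational {x : ℝ} (hx : Irrational x) {c d c' d' : ℤ}
    (h : (c : ℝ) * x + d = c' * x + d') : c = c' ∧ d = d' := by
  have := eq_zero_of_irrational hx (c := c - c') (d := d - d') (by push_cast; linarith)
  omega

lemma mobiusDenom_ne_zero (g : SL2Z) {x : ℝ} (hx : Irrational x) : mobiusDenom g x ≠ 0 := by
  intro h
  obtain ⟨hc, hd⟩ := eq_zero_of_irrational hx h
  have := SL2Z_det g
  simp [hc, hd] at this

lemma mobius_mul_mobiusDenom (g : SL2Z) {x : ℝ} (hx : Irrational x) :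
    mobius g x * mobiusDenom g x = (g.1 0 0 : ℝ) * x + g.1 0 1 :=
  div_mul_cancel₀ _ (mobiusDenom_ne_zero g hx)

lemma irrational_mobius (g : SL2Z) {x : ℝ} (hx : Irrational x) : Irrational (mobius g x) := by
  rintro ⟨q, hq⟩
  have h := mobius_mul_mobiusDenom g hx
  have hden : (q.den : ℝ) ≠ 0 := by exact_mod_cast q.den_nz
  rw [← hq, Rat.cast_def, mobiusDenom] at h
  field_simp at h
  have h2 : ((q.num * g.1 1 0 : ℤ) : ℝ) * x + ((q.num * g.1 1 1 : ℤ) : ℝ)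
      = ((q.den * g.1 0 0 : ℤ) : ℝ) * x + ((q.den * g.1 0 1 : ℤ) : ℝ) := by
    push_cast; linarith
  obtain ⟨h3, h4⟩ := coeffs_eq_of_irrational hx h2
  have := SL2Z_det g
  have : (q.den : ℤ) = 0 := by
    linear_combination (-(q.den : ℤ)) * this - g.1 1 1 * h3 + g.1 1 0 * h4
  exact q.den_nz (by exact_mod_cast this)

lemma mobiusDenom_mul (g h : SL2Z) {x : ℝ} (hx : Irrational x) :
    mobiusDenom (g * h) x = mobiusDenom g (mobius h x) * mobiusDenom h x := by
  have := mobius_mul_mobiusDenom h hx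
  have e : mobiusDenom g (mobius h x) * mobiusDenom h x
      = g.1 1 0 * (mobius h x * mobiusDenom h x) + g.1 1 1 * mobiusDenom h x := by
    simp only [mobiusDenom]; ring
  rw [e, this]
  simp [mobiusDenom, Matrix.mul_apply, Fin.sum_univ_two]
  ring

lemma mobius_mul (g h : SL2Z) {x : ℝ} (hx : Irrational x) :
    mobius (g * h) x = mobius g (mobius h x) := by
  have h1 := mobius_mul_mobiusDenom (g * h) hx
  have h2 := mobius_mul_mobiusDenom g (irrational_mobius h hx)
  have h3 := mobius_mul_mobiusDenom h hx
  apply mul_right_cancel₀ (mobiusDenom_ne_zero (g * h) hx)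
  rw [h1, mobiusDenom_mul g h hx, ← mul_assoc, h2]
  have e : ((g.1 0 0 : ℝ) * mobius h x + g.1 0 1) * mobiusDenom h x
      = g.1 0 0 * (mobius h x * mobiusDenom h x) + g.1 0 1 * mobiusDenom h x := by ring
  rw [e, h3]
  simp [mobiusDenom, Matrix.mul_apply, Fin.sum_univ_two]
  ring

lemma mobius_one (x : ℝ) : mobius 1 x = x := by
  simp [mobius]

lemma mobius_inv_mul_of_eq {a b : SL2Z} {x y : ℝ} (hx : Irrational x) (hy : Irrational y)
    (h : mobius a x = mobius b y) : mobius (b⁻¹ * a) x = y := by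
  rw [mobius_mul _ _ hx, h, ← mobius_mul _ _ hy, inv_mul_cancel, mobius_one]

lemma mobius_sub_mobius (g : SL2Z) {x y : ℝ} (hx : Irrational x) (hy : Irrational y) :
    mobius g x - mobius g y = (x - y) / (mobiusDenom g x * mobiusDenom g y) := by
  have h1 := mobiusDenom_ne_zero g hx
  have h2 := mobiusDenom_ne_zero g hy
  have h3 := mobius_mul_mobiusDenom g hx
  have h4 := mobius_mul_mobiusDenom g hy
  rw [eq_div_iff (mul_ne_zero h1 h2)]
  have e : (mobius g x - mobius g y) * (mobiusDenom g x * mobiusDenom g y)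
    = (mobius g x * mobiusDenom g x) * mobiusDenom g y
      - (mobius g y * mobiusDenom g y) * mobiusDenom g x := by ring
  rw [e, h3, h4]
  simp only [mobiusDenom]
  linear_combination (x - y) * SL2Z_det_real g

/-- The matrix of the translation `x ↦ x + k`. -/
def translationMatrix (k : ℤ) : SL2Z := ⟨!![1, k; 0, 1], by simp [Matrix.det_fin_two]⟩

lemma mobius_translationMatrix (k : ℤ) (x : ℝ) : mobius (translationMatrix k) x = x + k := by
  simp [mobius, translationMatrix]

lemma mobiusDenom_translationMatrix_mul (k : ℤ) (g : SL2Z) (x : ℝ) :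
    mobiusDenom (translationMatrix k * g) x = mobiusDenom g x := by
  have h : (translationMatrix k * g).1 = !![1, k; 0, 1] * g.1 := rfl
  simp [mobiusDenom, h, Matrix.mul_apply, Fin.sum_univ_two]

lemma unitAddCircle_coe_eq_iff {x y : ℝ} :
    (x : AddCircle (1 : ℝ)) = y ↔ ∃ k : ℤ, x = y + k := by
  rw [eq_comm, QuotientAddGroup.eq, AddSubgroup.mem_zmultiples_iff]
  simp only [zsmul_eq_mul, mul_one]
  exact exists_congr fun k => ⟨fun h => by linarith, fun h => by linarith⟩

lemma exists_mobius_eq_of_coe_eq {g g' : SL2Z} {x y : ℝ} (hx : Irrational x)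
    (hy : Irrational y) (h : (mobius g' x : AddCircle (1 : ℝ)) = mobius g y) :
    ∃ (k : ℤ) (a : SL2Z), mobius a x = y ∧ g' = translationMatrix k * g * a := by
  obtain ⟨k, hk⟩ := unitAddCircle_coe_eq_iff.1 h
  rw [← mobius_translationMatrix, ← mobius_mul _ _ hy] at hk
  exact ⟨k, _, mobius_inv_mul_of_eq hx hy hk, by group⟩

lemma coe_mobius_eq_of_bottom_row {g g' : SL2Z} (hc : g.1 1 0 = g'.1 1 0)
    (hd : g.1 1 1 = g'.1 1 1) {x : ℝ} (hx : Irrational x) :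
    (mobius g x : AddCircle (1 : ℝ)) = mobius g' x := by
  rw [unitAddCircle_coe_eq_iff]
  refine ⟨g.1 0 1 * g'.1 0 0 - g.1 0 0 * g'.1 0 1, ?_⟩
  apply mul_right_cancel₀ (mobiusDenom_ne_zero g hx)
  have e : mobiusDenom g x = mobiusDenom g' x := by simp [mobiusDenom, hc, hd]
  rw [mobius_mul_mobiusDenom g hx, add_mul, e, mobius_mul_mobiusDenom g' hx, ← e]
  have h1 := SL2Z_det_real g
  have h2 := SL2Z_det_real g'
  rw [← hc, ← hd] at h2
  simp only [mobiusDenom]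
  push_cast
  linear_combination ((g'.1 0 0 : ℝ) * x + g'.1 0 1) * h1 - ((g.1 0 0 : ℝ) * x + g.1 0 1) * h2

section Quadratic

variable {α α' : ℝ} {t n : ℤ}

lemma irrational_conj (hα : Irrational α) (hsum : α + α' = t) : Irrational α' := by
  have : α' = t - α := by linarith
  rw [this]
  exact hα.intCast_sub t

lemma mobiusDenom_mul_conj_of_fixed (hα : Irrational α) (hsum : α + α' = t) (hprod : α * α' = n)
    {a : SL2Z} (h : mobius a α = α) :
    mobiusDenom a α * mobiusDenom a α' = 1 ∧ mobius a α' = α' := by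
  have h1 := mobius_mul_mobiusDenom a hα
  have h' : α' = t - α := by linarith
  rw [h, mobiusDenom] at h1
  have h2 : ((a.1 1 0 * t + a.1 1 1 : ℤ) : ℝ) * α + ((-(a.1 1 0 * n) : ℤ) : ℝ)
      = (a.1 0 0 : ℝ) * α + a.1 0 1 := by
    rw [← h1]; push_cast; rw [← hsum, ← hprod]; ring
  obtain ⟨h3, h4⟩ := coeffs_eq_of_irrational hα h2
  have hdet := SL2Z_det_real a
  rw [← h3, ← h4] at hdet
  push_cast at hdet
  constructor
  · simp only [mobiusDenom]
    rw [← hdet, ← hsum, ← hprod]; ring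
  · apply mul_right_cancel₀ (mobiusDenom_ne_zero a (irrational_conj hα hsum))
    rw [mobius_mul_mobiusDenom a (irrational_conj hα hsum), ← h3, ← h4, mobiusDenom]
    push_cast
    rw [← hsum, ← hprod]; ring

lemma mobiusDenom_mul_conj_of_swap (hα : Irrational α) (hsum : α + α' = t) (hprod : α * α' = n)
    {a : SL2Z} (h : mobius a α = α') : mobiusDenom a α * mobiusDenom a α' = -1 := by
  have h1 := mobius_mul_mobiusDenom a hα
  have h' : α' = t - α := by linarith
  rw [h, mobiusDenom] at h1
  have h2 : ((-a.1 1 1 : ℤ) : ℝ) * α + ((a.1 1 1 * t + a.1 1 0 * n : ℤ) : ℝ)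
      = (a.1 0 0 : ℝ) * α + a.1 0 1 := by
    rw [← h1]; push_cast; rw [← hsum, ← hprod]; ring
  obtain ⟨h3, h4⟩ := coeffs_eq_of_irrational hα h2
  have hdet := SL2Z_det_real a
  rw [← h3, ← h4] at hdet
  push_cast at hdet
  simp only [mobiusDenom]
  rw [← hdet, ← hsum, ← hprod]; ring

lemma exists_swap_of_norm_eq_neg_one (hα : Irrational α) (hsum : α + α' = t)
    (hprod : α * α' = n) {c d : ℤ} (h : (c * α + d) * (c * α' + d) = -1) :
    ∃ a : SL2Z, mobius a α = α' ∧ mobius a α' = α := by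
  have hα' := irrational_conj hα hsum
  have hdet : (-d) * d - (d * t + c * n) * c = 1 := by
    have : (-(d : ℝ)) * d - (d * t + c * n) * c = 1 := by
      rw [← hsum, ← hprod]; linarith
    exact_mod_cast this
  let a : SL2Z := ⟨!![-d, d * t + c * n; c, d], by rw [Matrix.det_fin_two_of]; exact hdet⟩
  refine ⟨a, ?_, ?_⟩
  · apply mul_right_cancel₀ (mobiusDenom_ne_zero a hα)
    rw [mobius_mul_mobiusDenom a hα]
    simp [a, mobiusDenom]
    rw [← hsum, ← hprod]; ring
  · apply mul_right_cancel₀ (mobiusDenom_ne_zero a hα')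
    rw [mobius_mul_mobiusDenom a hα']
    simp [a, mobiusDenom]
    rw [← hsum, ← hprod]; ring

/-- Some matrix fixes `α` and `α'` and has automorphy factors `u` and `v` there. -/
def IsStabilizerFactor (α α' u v : ℝ) : Prop :=
  ∃ a : SL2Z, mobius a α = α ∧ mobius a α' = α' ∧ mobiusDenom a α = u ∧ mobiusDenom a α' = v

lemma IsStabilizerFactor.mul (hα : Irrational α) (hα' : Irrational α') {u v u₁ v₁ : ℝ}
    (h : IsStabilizerFactor α α' u v) (h₁ : IsStabilizerFactor α α' u₁ v₁) :
    IsStabilizerFactor α α' (u * u₁) (v * v₁) := by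
  obtain ⟨a, ha, ha', rfl, rfl⟩ := h
  obtain ⟨b, hb, hb', rfl, rfl⟩ := h₁
  refine ⟨a * b, ?_, ?_, ?_, ?_⟩
  · rw [mobius_mul _ _ hα, hb, ha]
  · rw [mobius_mul _ _ hα', hb', ha']
  · rw [mobiusDenom_mul _ _ hα, hb]
  · rw [mobiusDenom_mul _ _ hα', hb']

lemma isStabilizerFactor_of_norm_eq_one (hα : Irrational α) (hsum : α + α' = t)
    (hprod : α * α' = n) {c d : ℤ} (h : (c * α + d) * (c * α' + d) = 1) :
    IsStabilizerFactor α α' (c * α + d) (c * α' + d) := by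
  have hα' := irrational_conj hα hsum
  have hdet : (c * t + d) * d - (-(c * n)) * c = 1 := by
    have : (c * t + d) * d - (-(c * n)) * c = (1 : ℝ) := by
      rw [← hsum, ← hprod]; linarith
    exact_mod_cast this
  let a : SL2Z := ⟨!![c * t + d, -(c * n); c, d], by rw [Matrix.det_fin_two_of]; exact hdet⟩
  refine ⟨a, ?_, ?_, ?_, ?_⟩
  · apply mul_right_cancel₀ (mobiusDenom_ne_zero a hα)
    rw [mobius_mul_mobiusDenom a hα]
    simp [a, mobiusDenom]
    rw [← hsum, ← hprod]; ring
  · apply mul_right_cancel₀ (mobiusDenom_ne_zero a hα')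
    rw [mobius_mul_mobiusDenom a hα']
    simp [a, mobiusDenom]
    rw [← hsum, ← hprod]; ring
  · simp [a, mobiusDenom]
  · simp [a, mobiusDenom]

lemma isStabilizerFactor_zpow (hα : Irrational α) (hsum : α + α' = t)
    (hprod : α * α' = n) {c d : ℤ} (h : (c * α + d) * (c * α' + d) = 1) (k : ℤ) :
    IsStabilizerFactor α α' ((c * α + d) ^ k) ((c * α' + d) ^ k) := by
  have hα' := irrational_conj hα hsum
  have hu : (c * α + d) ≠ 0 := left_ne_zero_of_mul_eq_one h
  have hv : (c * α' + d) ≠ 0 := right_ne_zero_of_mul_eq_one h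
  induction k with
  | zero =>
    have := isStabilizerFactor_of_norm_eq_one hα hsum hprod (c := 0) (d := 1) (by simp)
    simpa using this
  | succ k ih =>
    rw [zpow_add_one₀ hu, zpow_add_one₀ hv]
    exact ih.mul hα hα' (isStabilizerFactor_of_norm_eq_one hα hsum hprod h)
  | pred k ih =>
    rw [zpow_sub_one₀ hu, zpow_sub_one₀ hv]
    refine ih.mul hα hα' ?_
    have e1 : (c * α + d)⁻¹ = ((-c : ℤ) : ℝ) * α + ((c * t + d : ℤ) : ℝ) := by
      rw [inv_eq_of_mul_eq_one_right h]; push_cast; rw [← hsum]; ring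
    have e2 : (c * α' + d)⁻¹ = ((-c : ℤ) : ℝ) * α' + ((c * t + d : ℤ) : ℝ) := by
      rw [inv_eq_of_mul_eq_one_left h]; push_cast; rw [← hsum]; ring
    rw [e1, e2]
    refine isStabilizerFactor_of_norm_eq_one hα hsum hprod ?_
    rw [← e1, ← e2, ← mul_inv, h, inv_one]

lemma IsStabilizerFactor.neg (hα : Irrational α) (hsum : α + α' = t) (hprod : α * α' = n)
    {u v : ℝ} (h : IsStabilizerFactor α α' u v) : IsStabilizerFactor α α' (-u) (-v) := by
  have := isStabilizerFactor_of_norm_eq_one hα hsum hprod (c := 0) (d := -1) (by simp)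
  simpa using h.mul hα (irrational_conj hα hsum) this

lemma exists_factor_of_coe_eq (hα : Irrational α) (hsum : α + α' = t)
    (hprod : α * α' = n) {g g' : SL2Z} (h : (mobius g' α : AddCircle (1 : ℝ)) = mobius g α) :
    ∃ c d : ℤ, (c * α + d) * (c * α' + d) = 1 ∧
      mobiusDenom g' α = mobiusDenom g α * (c * α + d) ∧
      mobiusDenom g' α' = mobiusDenom g α' * (c * α' + d) := by
  have hα' := irrational_conj hα hsum
  obtain ⟨k, a, ha, rfl⟩ := exists_mobius_eq_of_coe_eq hα hα h
  obtain ⟨h1, ha'⟩ := mobiusDenom_mul_conj_of_fixed hα hsum hprod ha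
  refine ⟨a.1 1 0, a.1 1 1, h1, ?_, ?_⟩
  · rw [mobiusDenom_mul _ _ hα, mobiusDenom_translationMatrix_mul, ha]; rfl
  · rw [mobiusDenom_mul _ _ hα', mobiusDenom_translationMatrix_mul, ha']; rfl

end Quadratic

/-- The pairs in a half-open cone on which `(x, y) ↦ (ε x, ε⁻¹ y)` and `(x, y) ↦ (-x, -y)`
act with exactly one representative per orbit. -/
def IsReducedPair (ε x y : ℝ) : Prop := 0 < x ∧ |y| ≤ x ∧ x < ε ^ 2 * |y|

/-- The coordinates `(c, d)` of reduced elements `c α + d` of norm at most `T`. -/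
def reducedLatticePoints (α α' ε T : ℝ) : Set (ℤ × ℤ) :=
  {p | IsReducedPair ε (p.1 * α + p.2) (p.1 * α' + p.2) ∧
    |(p.1 * α + p.2) * (p.1 * α' + p.2)| ≤ T}

lemma exists_zpow_isReducedPair {ε x y : ℝ} (hε : 1 < ε) (hx : x ≠ 0) (hy : y ≠ 0) :
    ∃ k : ℤ, IsReducedPair ε (x * ε ^ k) (y * ε⁻¹ ^ k) ∨
      IsReducedPair ε (x * -ε ^ k) (y * -ε⁻¹ ^ k) := by
  have hε2 : 1 < ε ^ 2 := by nlinarith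
  have hx' := abs_pos.2 hx
  have hy' := abs_pos.2 hy
  obtain ⟨m, h1, h2⟩ := exists_mem_Ico_zpow (div_pos hx' hy') hε2
  have hw : 0 < ε ^ m := zpow_pos (by linarith) m
  have e1 : (ε ^ 2) ^ m = (ε ^ m) ^ 2 := by
    rw [← zpow_natCast, ← zpow_natCast, ← zpow_mul, ← zpow_mul, mul_comm]
  rw [zpow_add_one₀ (by positivity), e1, div_lt_iff₀ hy'] at h2
  rw [e1, le_div_iff₀ hy'] at h1
  have k1 : |y| * ε ^ m ≤ |x| * (ε ^ m)⁻¹ := by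
    rw [← div_eq_mul_inv, le_div_iff₀ hw]; nlinarith
  have k2 : |x| * (ε ^ m)⁻¹ < ε ^ 2 * (|y| * ε ^ m) := by
    rw [← div_eq_mul_inv, div_lt_iff₀ hw]; nlinarith
  refine ⟨-m, ?_⟩
  rw [inv_zpow', neg_neg, zpow_neg]
  rcases lt_or_gt_of_ne hx with h | h
  · right
    refine ⟨by nlinarith [inv_pos.2 hw], ?_, ?_⟩
    · rw [abs_mul, abs_neg, abs_of_pos hw]; rw [abs_of_neg h] at k1; linarith
    · rw [abs_mul, abs_neg, abs_of_pos hw]; rw [abs_of_neg h] at k2; linarith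
  · left
    refine ⟨by positivity, ?_, ?_⟩
    · rw [abs_mul, abs_of_pos hw]; rw [abs_of_pos h] at k1; linarith
    · rw [abs_mul, abs_of_pos hw]; rw [abs_of_pos h] at k2; linarith

lemma eq_one_of_isReducedPair {α α' ε x y : ℝ} (hε : 1 < ε)
    (hmin : ∀ c d : ℤ, (c * α + d) * (c * α' + d) = 1 → c ≠ 0 → ε - ε⁻¹ ≤ |c * (α - α')|)
    {c d : ℤ} (h1 : (c * α + d) * (c * α' + d) = 1) (hxy : IsReducedPair ε x y)
    (hxy' : IsReducedPair ε (x * (c * α + d)) (y * (c * α' + d))) :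
    (c * α + d) = 1 ∧ (c * α' + d) = 1 := by
  obtain ⟨hx, hyx, hxe⟩ := hxy
  obtain ⟨hx', hyx', hxe'⟩ := hxy'
  have hmin' := hmin c d h1
  have hsub : c * (α - α') = (c * α + d) - (c * α' + d) := by ring
  rw [hsub] at hmin'
  have hu : 0 < c * α + d := by
    by_contra! h; nlinarith
  have hv : 0 < c * α' + d := by
    by_contra! h; nlinarith
  have hc : c = 0 := by
    by_contra hc
    have h2 := hmin' hc
    clear hmin' hmin hsub
    generalize c * α + d = u at *
    generalize c * α' + d = v at *
    rw [abs_mul, abs_of_pos hv] at hyx' hxe'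
    have hy : 0 < |y| := by
      by_contra! h
      nlinarith
    have a1 : u < ε ^ 2 * v := by
      have : x * u < x * (ε ^ 2 * v) := by
        calc x * u < ε ^ 2 * (|y| * v) := hxe'
          _ ≤ ε ^ 2 * (x * v) := by gcongr
          _ = _ := by ring
      exact lt_of_mul_lt_mul_left this hx.le
    have a2 : v < ε ^ 2 * u := by
      have : |y| * v < |y| * (ε ^ 2 * u) := by
        calc |y| * v ≤ x * u := hyx'
          _ < (ε ^ 2 * |y|) * u := by gcongr
          _ = _ := by ring
      exact lt_of_mul_lt_mul_left this hy.le
    have b1 : u < ε := by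
      apply lt_of_pow_lt_pow_left₀ 2 (by linarith); nlinarith
    have b2 : v < ε := by
      apply lt_of_pow_lt_pow_left₀ 2 (by linarith); nlinarith
    have hvu : v = u⁻¹ := eq_inv_of_mul_eq_one_right h1
    have huv : u = v⁻¹ := eq_inv_of_mul_eq_one_left h1
    have b3 : ε⁻¹ < v := by rw [hvu]; exact inv_strictAnti₀ hu b1
    have b4 : ε⁻¹ < u := by rw [huv]; exact inv_strictAnti₀ hv b2
    rcases abs_cases (u - v) with ⟨h, _⟩ | ⟨h, _⟩ <;> linarith
  subst hc
  simp only [Int.cast_zero, zero_mul, zero_add] at *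
  have : (d : ℝ) = 1 := by nlinarith
  exact ⟨this, this⟩

/-- The classes modulo `ℤ` of the `mobius g x` with `|g α - g α'|⁻¹ ≤ s`. -/
def mobiusClasses (α α' s x : ℝ) : Set (AddCircle (1 : ℝ)) :=
  {z | ∃ g : SL2Z, z = mobius g x ∧ |mobius g α - mobius g α'|⁻¹ ≤ s}

section Count

variable {α α' : ℝ} {t n : ℤ}

lemma inv_abs_mobius_sub_le_iff (hα : Irrational α) (hα' : Irrational α') (hδ : 0 < α - α')
    (g : SL2Z) (s : ℝ) :
    |mobius g α - mobius g α'|⁻¹ ≤ s ↔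
      |mobiusDenom g α * mobiusDenom g α'| ≤ s * (α - α') := by
  rw [mobius_sub_mobius g hα hα', abs_div, inv_div, abs_of_pos hδ, div_le_iff₀ hδ]

/-- A matrix with bottom row `p`, when `p` is coprime. -/
noncomputable def bottomRowLift (p : ℤ × ℤ) : SL2Z :=
  Classical.epsilon fun g : SL2Z => g.1 1 0 = p.1 ∧ g.1 1 1 = p.2

lemma bottomRowLift_spec {p : ℤ × ℤ} (hp : IsCoprime p.1 p.2) :
    (bottomRowLift p).1 1 0 = p.1 ∧ (bottomRowLift p).1 1 1 = p.2 := by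
  apply Classical.epsilon_spec (p := fun g : SL2Z => g.1 1 0 = p.1 ∧ g.1 1 1 = p.2)
  obtain ⟨g, -, hg⟩ := ModularGroup.bottom_row_surj (R := ℤ) (a := ![p.1, p.2])
    (by simpa using hp)
  exact ⟨g, by simpa using congrFun hg 0, by simpa using congrFun hg 1⟩

lemma mobiusDenom_bottomRowLift {p : ℤ × ℤ} (hp : IsCoprime p.1 p.2) (x : ℝ) :
    mobiusDenom (bottomRowLift p) x = p.1 * x + p.2 := by
  simp [mobiusDenom, bottomRowLift_spec hp]

lemma mobiusClasses_eq_image (hα : Irrational α) (hsum : α + α' = t) (hprod : α * α' = n)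
    (hδ : 0 < α - α') {c₀ d₀ : ℤ} (h₀ : (c₀ * α + d₀) * (c₀ * α' + d₀) = 1)
    (hε : 1 < c₀ * α + d₀) (s : ℝ) {x : ℝ} (hx : x = α ∨ x = α') :
    mobiusClasses α α' s x =
      (fun p : ℤ × ℤ => (mobius (bottomRowLift p) x : AddCircle (1 : ℝ))) ''
        {p ∈ reducedLatticePoints α α' (c₀ * α + d₀) (s * (α - α')) | IsCoprime p.1 p.2} := by
  have hα' := irrational_conj hα hsum
  have hxirr : Irrational x := by rcases hx with rfl | rfl <;> assumption
  ext z
  constructor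
  · rintro ⟨g, rfl, hg⟩
    rw [inv_abs_mobius_sub_le_iff hα hα' hδ] at hg
    obtain ⟨k, hk⟩ := exists_zpow_isReducedPair hε (mobiusDenom_ne_zero g hα)
      (mobiusDenom_ne_zero g hα')
    rw [inv_eq_of_mul_eq_one_right h₀] at hk
    have hfac := isStabilizerFactor_zpow hα hsum hprod h₀ k
    have key : ∃ u v, IsStabilizerFactor α α' u v ∧ |u * v| = 1 ∧
        IsReducedPair (c₀ * α + d₀) (mobiusDenom g α * u) (mobiusDenom g α' * v) := by
      have h1 : (c₀ * α + d₀) ^ k * (c₀ * α' + d₀) ^ k = 1 := by rw [← mul_zpow, h₀, one_zpow]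
      rcases hk with hk | hk
      · exact ⟨_, _, hfac, by rw [h1, abs_one], hk⟩
      · exact ⟨_, _, hfac.neg hα hsum hprod, by rw [neg_mul_neg, h1, abs_one], hk⟩
    obtain ⟨u, v, ⟨a, ha, ha', rfl, rfl⟩, huv, hred⟩ := key
    have e1 : mobiusDenom (g * a) α = mobiusDenom g α * mobiusDenom a α := by
      rw [mobiusDenom_mul _ _ hα, ha]
    have e2 : mobiusDenom (g * a) α' = mobiusDenom g α' * mobiusDenom a α' := by
      rw [mobiusDenom_mul _ _ hα', ha']
    rw [← e1, ← e2] at hred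
    have hcop : IsCoprime ((g * a).1 1 0) ((g * a).1 1 1) := ModularGroup.bottom_row_coprime _
    refine ⟨((g * a).1 1 0, (g * a).1 1 1), ⟨⟨hred, ?_⟩, hcop⟩, ?_⟩
    · change |mobiusDenom (g * a) α * mobiusDenom (g * a) α'| ≤ _
      rw [e1, e2, mul_mul_mul_comm, abs_mul, huv, mul_one]
      exact hg
    · obtain ⟨l1, l2⟩ := bottomRowLift_spec
        (p := ((g * a).1 1 0, (g * a).1 1 1)) hcop
      have : mobius g x = mobius (g * a) x := by
        rw [mobius_mul _ _ hxirr]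
        rcases hx with rfl | rfl
        · rw [ha]
        · rw [ha']
      dsimp only
      rw [this]
      exact coe_mobius_eq_of_bottom_row l1 l2 hxirr
  · rintro ⟨p, ⟨⟨-, hp⟩, hcop⟩, rfl⟩
    refine ⟨bottomRowLift p, rfl, ?_⟩
    rw [inv_abs_mobius_sub_le_iff hα hα' hδ, mobiusDenom_bottomRowLift hcop,
      mobiusDenom_bottomRowLift hcop]
    exact hp

lemma ncard_mobiusClasses (hα : Irrational α) (hsum : α + α' = t) (hprod : α * α' = n)
    (hδ : 0 < α - α') {c₀ d₀ : ℤ} (h₀ : (c₀ * α + d₀) * (c₀ * α' + d₀) = 1)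
    (hε : 1 < c₀ * α + d₀)
    (hmin : ∀ c d : ℤ, (c * α + d) * (c * α' + d) = 1 → c ≠ 0 →
      (c₀ * α + d₀) - (c₀ * α + d₀)⁻¹ ≤ |c * (α - α')|)
    (s : ℝ) {x : ℝ} (hx : x = α ∨ x = α') :
    (mobiusClasses α α' s x).ncard =
      {p ∈ reducedLatticePoints α α' (c₀ * α + d₀) (s * (α - α')) |
        IsCoprime p.1 p.2}.ncard := by
  have hα' := irrational_conj hα hsum
  rw [mobiusClasses_eq_image hα hsum hprod hδ h₀ hε s hx]
  apply Set.InjOn.ncard_image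
  rintro p ⟨⟨hp, -⟩, hcop⟩ q ⟨⟨hq, -⟩, hcoq⟩ hpq
  have key : ∃ c d : ℤ, (c * α + d) * (c * α' + d) = 1 ∧
      q.1 * α + q.2 = (p.1 * α + p.2) * (c * α + d) ∧
      q.1 * α' + q.2 = (p.1 * α' + p.2) * (c * α' + d) := by
    simp only [← mobiusDenom_bottomRowLift hcop, ← mobiusDenom_bottomRowLift hcoq]
    rcases hx with rfl | rfl
    · exact exists_factor_of_coe_eq hα hsum hprod hpq.symm
    · obtain ⟨c, d, h1, h2, h3⟩ := exists_factor_of_coe_eq hα' (t := t) (n := n)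
        (by rw [add_comm]; exact hsum) (by rw [mul_comm]; exact hprod) hpq.symm
      exact ⟨c, d, by rw [mul_comm]; exact h1, h3, h2⟩
  obtain ⟨c, d, h1, h2, h3⟩ := key
  rw [h2, h3] at hq
  obtain ⟨h4, -⟩ := eq_one_of_isReducedPair hε hmin h1 hp hq
  rw [h4, mul_one] at h2
  obtain ⟨h5, h6⟩ := coeffs_eq_of_irrational hα h2
  exact Prod.ext h5.symm h6.symm

lemma image_eq_mobiusClasses_union (α α' s : ℝ) :
    (fun a : ℝ => (a : AddCircle (1 : ℝ))) ''
      {a : ℝ | ∃ g : SL2Z, (a = mobius g α ∨ a = mobius g α') ∧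
        |mobius g α - mobius g α'|⁻¹ ≤ s} =
      mobiusClasses α α' s α ∪ mobiusClasses α α' s α' := by
  ext z
  constructor
  · rintro ⟨a, ⟨g, rfl | rfl, hg⟩, rfl⟩
    · exact Or.inl ⟨g, rfl, hg⟩
    · exact Or.inr ⟨g, rfl, hg⟩
  · rintro (⟨g, rfl, hg⟩ | ⟨g, rfl, hg⟩)
    · exact ⟨_, ⟨g, Or.inl rfl, hg⟩, rfl⟩
    · exact ⟨_, ⟨g, Or.inr rfl, hg⟩, rfl⟩

lemma mobiusClasses_conj_eq (hα : Irrational α) (hsum : α + α' = t) (hprod : α * α' = n)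
    {c d : ℤ} (h : (c * α + d) * (c * α' + d) = -1) (s : ℝ) :
    mobiusClasses α α' s α' = mobiusClasses α α' s α := by
  have hα' := irrational_conj hα hsum
  obtain ⟨a, ha, ha'⟩ := exists_swap_of_norm_eq_neg_one hα hsum hprod h
  ext z
  constructor
  · rintro ⟨g, rfl, hg⟩
    refine ⟨g * a, ?_, ?_⟩
    · rw [mobius_mul _ _ hα, ha]
    · rwa [mobius_mul _ _ hα, mobius_mul _ _ hα', ha, ha', abs_sub_comm]
  · rintro ⟨g, rfl, hg⟩
    refine ⟨g * a, ?_, ?_⟩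
    · rw [mobius_mul _ _ hα', ha']
    · rwa [mobius_mul _ _ hα, mobius_mul _ _ hα', ha, ha', abs_sub_comm]

lemma disjoint_mobiusClasses (hα : Irrational α) (hsum : α + α' = t) (hprod : α * α' = n)
    (h : ¬ ∃ c d : ℤ, (c * α + d) * (c * α' + d) = -1) (s : ℝ) :
    Disjoint (mobiusClasses α α' s α) (mobiusClasses α α' s α') := by
  have hα' := irrational_conj hα hsum
  rw [Set.disjoint_left]
  rintro z ⟨g, rfl, -⟩ ⟨g', hz, -⟩
  obtain ⟨k, a, ha, -⟩ := exists_mobius_eq_of_coe_eq hα hα' hz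
  exact h ⟨_, _, mobiusDenom_mul_conj_of_swap hα hsum hprod ha⟩

end Count

section Primitive

open Filter Topology

lemma tsum_moebius_div_sq :
    ∑' k : ℕ, (ArithmeticFunction.moebius k : ℝ) / (k : ℝ) ^ 2 = 6 / π ^ 2 := by
  have h := ArithmeticFunction.LSeries_zeta_mul_Lseries_moebius (s := 2) (by norm_num)
  rw [ArithmeticFunction.LSeries_zeta_eq_riemannZeta (by norm_num), riemannZeta_two] at h
  have h2 : LSeries (fun k => ((ArithmeticFunction.moebius k : ℤ) : ℂ)) 2
      = ((∑' k : ℕ, (ArithmeticFunction.moebius k : ℝ) / (k : ℝ) ^ 2 : ℝ) : ℂ) := by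
    rw [LSeries, Complex.ofReal_tsum]
    refine tsum_congr fun k => ?_
    rcases eq_or_ne k 0 with rfl | hk
    · simp
    · rw [LSeries.term_of_ne_zero hk]
      push_cast
      norm_cast
  rw [h2] at h
  have h3 : π ^ 2 / 6 * ∑' k : ℕ, (ArithmeticFunction.moebius k : ℝ) / (k : ℝ) ^ 2 = 1 := by
    exact_mod_cast h
  have hpi := Real.pi_pos
  rw [eq_div_iff (by positivity)]
  linarith

lemma sum_moebius_dvd (m K : ℕ) (hm : m ≠ 0) (hK : m ≤ K) :
    ∑ k ∈ Finset.Icc 1 K, (if k ∣ m then ArithmeticFunction.moebius k else 0)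
      = if m = 1 then 1 else 0 := by
  rw [← Finset.sum_filter]
  have : (Finset.Icc 1 K).filter (· ∣ m) = m.divisors := by
    ext k
    simp only [Finset.mem_filter, Finset.mem_Icc, Nat.mem_divisors]
    constructor
    · rintro ⟨-, h⟩; exact ⟨h, hm⟩
    · rintro ⟨h, -⟩
      have := Nat.le_of_dvd (Nat.pos_of_ne_zero hm) h
      have := Nat.pos_of_dvd_of_pos h (Nat.pos_of_ne_zero hm)
      exact ⟨⟨by omega, by omega⟩, h⟩
  rw [this, ← ArithmeticFunction.coe_mul_zeta_apply, ArithmeticFunction.moebius_mul_coe_zeta,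
    ArithmeticFunction.one_apply]

variable {U : ℝ → Set (ℤ × ℤ)}

lemma ncard_filter_dvd (hscale : ∀ (k : ℕ) (p : ℤ × ℤ) (T : ℝ), 0 < k →
      ((k * p.1, k * p.2) ∈ U T ↔ p ∈ U (T / k ^ 2))) (T : ℝ) {k : ℕ} (hk : 0 < k) :
    {p ∈ U T | k ∣ Int.gcd p.1 p.2}.ncard = (U (T / k ^ 2)).ncard := by
  have himg : {p ∈ U T | k ∣ Int.gcd p.1 p.2} =
      (fun p : ℤ × ℤ => ((k * p.1, k * p.2) : ℤ × ℤ)) '' U (T / k ^ 2) := by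
    ext ⟨a, b⟩
    constructor
    · rintro ⟨h1, h2⟩
      obtain ⟨a', rfl⟩ : (k : ℤ) ∣ a := (Int.natCast_dvd_natCast.2 h2).trans (Int.gcd_dvd_left ..)
      obtain ⟨b', rfl⟩ : (k : ℤ) ∣ b := (Int.natCast_dvd_natCast.2 h2).trans (Int.gcd_dvd_right ..)
      exact ⟨(a', b'), (hscale k (a', b') T hk).1 h1, rfl⟩
    · rintro ⟨⟨a', b'⟩, h, h2⟩
      simp only [Prod.mk.injEq] at h2
      obtain ⟨rfl, rfl⟩ := h2
      refine ⟨(hscale k (a', b') T hk).2 h, ?_⟩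
      simp only [Int.gcd_mul_left, Int.natAbs_natCast]
      exact dvd_mul_right _ _
  rw [himg]
  apply Set.InjOn.ncard_image
  rintro ⟨a, b⟩ - ⟨a', b'⟩ - h
  simpa [hk.ne'] using h

lemma ncard_coprime_eq_tsum (hfin : ∀ T, (U T).Finite) (hzero : ∀ T, (0, 0) ∉ U T)
    (hlt : ∀ T < 1, U T = ∅)
    (hscale : ∀ (k : ℕ) (p : ℤ × ℤ) (T : ℝ), 0 < k →
      ((k * p.1, k * p.2) ∈ U T ↔ p ∈ U (T / k ^ 2))) (T : ℝ) :
    ({p ∈ U T | IsCoprime p.1 p.2}.ncard : ℝ) =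
      ∑' k : ℕ, (ArithmeticFunction.moebius k : ℝ) * (U (T / k ^ 2)).ncard := by
  classical
  set V := (hfin T).toFinset with hV
  set K := max ⌊T⌋₊ (V.sup fun p => Int.gcd p.1 p.2) with hK
  have hsum : ∑' k : ℕ, (ArithmeticFunction.moebius k : ℝ) * (U (T / k ^ 2)).ncard =
      ∑ k ∈ Finset.Icc 1 K, (ArithmeticFunction.moebius k : ℝ) * (U (T / k ^ 2)).ncard := by
    apply tsum_eq_sum
    intro k hk
    rcases Nat.eq_zero_or_pos k with rfl | hk0
    · simp
    · have hkK : K < k := by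
        by_contra! h
        exact hk (Finset.mem_Icc.2 ⟨hk0, h⟩)
      have hk1 : T < k := Nat.lt_of_floor_lt ((le_max_left _ _).trans_lt hkK)
      have hk2 : (1 : ℝ) ≤ k := by exact_mod_cast hk0
      rw [hlt, Set.ncard_empty]
      · simp
      · rw [div_lt_one (by positivity)]; nlinarith
  rw [hsum]
  have h1 : ∀ k ∈ Finset.Icc 1 K,
      (ArithmeticFunction.moebius k : ℝ) * (U (T / k ^ 2)).ncard =
        ((∑ p ∈ V, if k ∣ Int.gcd p.1 p.2 then ArithmeticFunction.moebius k else 0 : ℤ) : ℝ) := by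
    intro k hk
    rw [← ncard_filter_dvd hscale T (Finset.mem_Icc.1 hk).1, ← Finset.sum_filter,
      Finset.sum_const]
    have : {p ∈ U T | k ∣ Int.gcd p.1 p.2} =
        ((V.filter fun p => k ∣ Int.gcd p.1 p.2 : Finset (ℤ × ℤ)) : Set (ℤ × ℤ)) := by
      ext p; simp [hV]
    rw [this, Set.ncard_coe_finset]
    simp [mul_comm]
  rw [Finset.sum_congr rfl h1, ← Int.cast_sum, Finset.sum_comm]
  have h2 : ∀ p ∈ V, (∑ k ∈ Finset.Icc 1 K,
      if k ∣ Int.gcd p.1 p.2 then ArithmeticFunction.moebius k else 0) =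
        if Int.gcd p.1 p.2 = 1 then 1 else 0 := by
    intro p hp
    apply sum_moebius_dvd
    · intro h
      rw [Int.gcd_eq_zero_iff] at h
      have : p = (0, 0) := Prod.ext h.1 h.2
      exact hzero T (this ▸ (hfin T).mem_toFinset.1 hp)
    · exact (Finset.le_sup (f := fun p : ℤ × ℤ => Int.gcd p.1 p.2) hp).trans (le_max_right _ _)
  rw [Finset.sum_congr rfl h2, ← Finset.sum_filter, Finset.sum_const]
  have : {p ∈ U T | IsCoprime p.1 p.2} =
      ((V.filter fun p => Int.gcd p.1 p.2 = 1 : Finset (ℤ × ℤ)) : Set (ℤ × ℤ)) := by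
    ext p; simp [hV, Int.isCoprime_iff_gcd_eq_one]
  rw [this, Set.ncard_coe_finset]
  simp

lemma exists_forall_ncard_le (hfin : ∀ T, (U T).Finite) (hlt : ∀ T < 1, U T = ∅)
    (hmono : ∀ S T, S ≤ T → U S ⊆ U T) {c : ℝ}
    (hlim : Tendsto (fun T : ℝ => ((U T).ncard : ℝ) / T) atTop (𝓝 c)) :
    ∃ C : ℝ, ∀ T : ℝ, 0 < T → ((U T).ncard : ℝ) ≤ C * T := by
  obtain ⟨T₁, hT₁⟩ := eventually_atTop.1 (hlim.eventually (gt_mem_nhds (lt_add_one c)))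
  refine ⟨max (c + 1) (U T₁).ncard, fun T hT => ?_⟩
  rcases lt_or_ge T 1 with h | h
  · rw [hlt T h]
    simp only [Set.ncard_empty, Nat.cast_zero]
    have : (0 : ℝ) ≤ (U T₁).ncard := by positivity
    exact mul_nonneg (this.trans (le_max_right _ _)) hT.le
  · rcases le_total T₁ T with h2 | h2
    · have := hT₁ T h2
      rw [div_lt_iff₀ hT] at this
      exact this.le.trans (by gcongr; exact le_max_left _ _)
    · have h3 : ((U T).ncard : ℝ) ≤ (U T₁).ncard := by
        exact_mod_cast Set.ncard_le_ncard (hmono T T₁ h2) (hfin _)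
      have : (0 : ℝ) ≤ (U T₁).ncard := by positivity
      calc ((U T).ncard : ℝ) ≤ (U T₁).ncard * 1 := by simpa using h3
        _ ≤ (U T₁).ncard * T := by gcongr
        _ ≤ _ := by gcongr; exact le_max_right _ _

/-- If the number of integer points in a family of sets `U T` scaling like `U (k² T) = k U T`
is asymptotic to `c T`, then the number of primitive points is asymptotic to `6 / π² c T`. -/
lemma tendsto_ncard_coprime_div (hfin : ∀ T, (U T).Finite) (hzero : ∀ T, (0, 0) ∉ U T)
    (hlt : ∀ T < 1, U T = ∅) (hmono : ∀ S T, S ≤ T → U S ⊆ U T)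
    (hscale : ∀ (k : ℕ) (p : ℤ × ℤ) (T : ℝ), 0 < k →
      ((k * p.1, k * p.2) ∈ U T ↔ p ∈ U (T / k ^ 2))) {c : ℝ}
    (hlim : Tendsto (fun T : ℝ => ((U T).ncard : ℝ) / T) atTop (𝓝 c)) :
    Tendsto (fun T : ℝ => ({p ∈ U T | IsCoprime p.1 p.2}.ncard : ℝ) / T) atTop
      (𝓝 (6 / π ^ 2 * c)) := by
  obtain ⟨C, hC⟩ := exists_forall_ncard_le hfin hlt hmono hlim
  have hC0 : 0 ≤ C := by
    have := hC 1 one_pos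
    have h2 : (0 : ℝ) ≤ (U 1).ncard := by positivity
    linarith
  rw [← tsum_moebius_div_sq, ← tsum_mul_right]
  have e : (fun T : ℝ => ({p ∈ U T | IsCoprime p.1 p.2}.ncard : ℝ) / T) =
      fun T : ℝ => ∑' k : ℕ, (ArithmeticFunction.moebius k : ℝ) * (U (T / k ^ 2)).ncard / T := by
    funext T
    rw [ncard_coprime_eq_tsum hfin hzero hlt hscale, tsum_div_const]
  rw [e]
  refine tendsto_tsum_of_dominated_convergence (bound := fun k : ℕ => C * (1 / (k : ℝ) ^ 2))
    ((Real.summable_one_div_nat_pow.2 one_lt_two).mul_left C) ?_ ?_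
  · intro k
    rcases Nat.eq_zero_or_pos k with rfl | hk
    · simp
    · have hk' : (0 : ℝ) < k ^ 2 := by positivity
      have h1 := (hlim.comp (tendsto_id.atTop_div_const hk')).const_mul
        ((ArithmeticFunction.moebius k : ℝ) / (k : ℝ) ^ 2)
      refine h1.congr' ?_
      filter_upwards [eventually_gt_atTop 0] with T hT
      simp only [Function.comp_apply, id]
      field_simp
  · filter_upwards [eventually_gt_atTop 0] with T hT k
    rcases Nat.eq_zero_or_pos k with rfl | hk
    · simp
    · have hk' : (0 : ℝ) < k ^ 2 := by positivity
      have h1 := hC (T / k ^ 2) (by positivity)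
      have h2 : |(ArithmeticFunction.moebius k : ℝ)| ≤ 1 := by
        exact_mod_cast ArithmeticFunction.abs_moebius_le_one (n := k)
      rw [Real.norm_eq_abs, abs_div, abs_mul, abs_of_pos hT, Nat.abs_cast, div_le_iff₀ hT]
      calc |(ArithmeticFunction.moebius k : ℝ)| * ((U (T / k ^ 2)).ncard : ℝ)
          ≤ 1 * (C * (T / k ^ 2)) := by gcongr
        _ = _ := by ring

end Primitive

section Area

open MeasureTheory Filter Topology

lemma volume_isReducedPair_slice {ε x : ℝ} (hε : 1 < ε) (hx : 0 < x) :
    volume {y : ℝ | IsReducedPair ε x y ∧ |x * y| ≤ 1} =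
      ENNReal.ofReal (2 * (min x x⁻¹ - x / ε ^ 2)) := by
  have hε2 : 0 < ε ^ 2 := by positivity
  have h : {y : ℝ | IsReducedPair ε x y ∧ |x * y| ≤ 1} =
      Set.Ioc (x / ε ^ 2) (min x x⁻¹) ∪ Set.Ico (-min x x⁻¹) (-(x / ε ^ 2)) := by
    ext y
    have e1 : x < ε ^ 2 * |y| ↔ x / ε ^ 2 < |y| := by
      rw [div_lt_iff₀ hε2, mul_comm]
    have e2 : |x * y| ≤ 1 ↔ |y| ≤ x⁻¹ := by
      rw [abs_mul, abs_of_pos hx, ← one_div, le_div_iff₀ hx, mul_comm]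
    have hpos : 0 < x / ε ^ 2 := by positivity
    simp only [IsReducedPair, Set.mem_ofPred_eq, e1, e2, Set.mem_union, Set.mem_Ioc, Set.mem_Ico,
      hx, true_and]
    rw [and_right_comm, ← le_min_iff]
    generalize min x x⁻¹ = m
    rcases abs_cases y with ⟨h, h'⟩ | ⟨h, h'⟩ <;> rw [h] <;> constructor
    · rintro ⟨h1, h2⟩; exact Or.inl ⟨h2, h1⟩
    · rintro (⟨h1, h2⟩ | ⟨h1, h2⟩)
      · exact ⟨h2, h1⟩
      · constructor <;> linarith
    · rintro ⟨h1, h2⟩; right; constructor <;> linarith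
    · rintro (⟨h1, h2⟩ | ⟨h1, h2⟩) <;> constructor <;> linarith
  have hdisj : Disjoint (Set.Ioc (x / ε ^ 2) (min x x⁻¹))
      (Set.Ico (-min x x⁻¹) (-(x / ε ^ 2))) := by
    rw [Set.disjoint_left]
    rintro y ⟨h1, -⟩ ⟨-, h2⟩
    have hpos : 0 < x / ε ^ 2 := by positivity
    linarith
  rw [h, measure_union hdisj measurableSet_Ico, Real.volume_Ioc, Real.volume_Ico,
    ENNReal.ofReal_mul two_pos.le, ENNReal.ofReal_ofNat, two_mul]
  congr 2
  ring

lemma measurableSet_isReducedPair (ε : ℝ) :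
    MeasurableSet {q : ℝ × ℝ | IsReducedPair ε q.1 q.2 ∧ |q.1 * q.2| ≤ 1} := by
  have m1 : MeasurableSet {q : ℝ × ℝ | 0 < q.1} := measurableSet_lt (by fun_prop) (by fun_prop)
  have m2 : MeasurableSet {q : ℝ × ℝ | |q.2| ≤ q.1} := measurableSet_le (by fun_prop) (by fun_prop)
  have m3 : MeasurableSet {q : ℝ × ℝ | q.1 < ε ^ 2 * |q.2|} :=
    measurableSet_lt (by fun_prop) (by fun_prop)
  have m4 : MeasurableSet {q : ℝ × ℝ | |q.1 * q.2| ≤ 1} :=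
    measurableSet_le (by fun_prop) (by fun_prop)
  exact (m1.inter (m2.inter m3)).inter m4

lemma volume_isReducedPair_prod {ε : ℝ} (hε : 1 < ε) :
    volume {q : ℝ × ℝ | IsReducedPair ε q.1 q.2 ∧ |q.1 * q.2| ≤ 1} =
      ENNReal.ofReal (2 * Real.log ε) := by
  have hε0 : 0 < ε := by linarith
  have hε2 : (1 : ℝ) < ε ^ 2 := by nlinarith
  rw [Measure.volume_eq_prod, Measure.prod_apply (measurableSet_isReducedPair ε)]
  have hslice : ∀ x : ℝ, volume (Prod.mk x ⁻¹'
      {q : ℝ × ℝ | IsReducedPair ε q.1 q.2 ∧ |q.1 * q.2| ≤ 1}) =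
      (Set.Ioc 0 1).indicator (fun x => ENNReal.ofReal (2 * (x - x / ε ^ 2))) x +
      (Set.Ioc 1 ε).indicator (fun x => ENNReal.ofReal (2 * (x⁻¹ - x / ε ^ 2))) x := by
    intro x
    change volume {y : ℝ | IsReducedPair ε x y ∧ |x * y| ≤ 1} = _
    rcases le_or_gt x 0 with hx | hx
    · have : {y : ℝ | IsReducedPair ε x y ∧ |x * y| ≤ 1} = ∅ := by
        ext y
        simp only [Set.mem_ofPred_eq, Set.mem_empty_iff_false, iff_false]
        rintro ⟨⟨h, -⟩, -⟩
        linarith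
      rw [this, Set.indicator_of_notMem (fun h => by linarith [h.1]),
        Set.indicator_of_notMem (fun h => by linarith [h.1])]
      simp
    · rw [volume_isReducedPair_slice hε hx]
      rcases le_or_gt x 1 with hx1 | hx1
      · rw [Set.indicator_of_mem (Set.mem_Ioc.2 ⟨hx, hx1⟩),
          Set.indicator_of_notMem (fun h => by linarith [h.1]),
          add_zero, min_eq_left (hx1.trans (one_le_inv_iff₀.2 ⟨hx, hx1⟩))]
      · rw [Set.indicator_of_notMem (fun h => by linarith [h.2]),
          min_eq_right ((inv_lt_one_of_one_lt₀ hx1).le.trans hx1.le), zero_add]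
        rcases le_or_gt x ε with hx2 | hx2
        · rw [Set.indicator_of_mem (Set.mem_Ioc.2 ⟨hx1, hx2⟩)]
        · rw [Set.indicator_of_notMem (fun h => by linarith [h.2])]
          apply ENNReal.ofReal_of_nonpos
          have : x⁻¹ ≤ x / ε ^ 2 := by
            rw [inv_eq_one_div, div_le_div_iff₀ hx (by positivity)]
            nlinarith
          linarith
  simp_rw [hslice]
  rw [lintegral_add_left (Measurable.indicator (by fun_prop) measurableSet_Ioc),
    lintegral_indicator measurableSet_Ioc, lintegral_indicator measurableSet_Ioc]
  have c1 : Continuous fun x : ℝ => 2 * (x - x / ε ^ 2) := by fun_prop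
  have i1 : IntegrableOn (fun x : ℝ => 2 * (x - x / ε ^ 2)) (Set.Ioc 0 1) :=
    (c1.intervalIntegrable 0 1).1
  have j1 : IntervalIntegrable (fun x : ℝ => x⁻¹) volume 1 ε :=
    intervalIntegral.intervalIntegrable_inv
      (fun x hx => by rw [Set.uIcc_of_le hε.le] at hx; linarith [hx.1]) continuousOn_id
  have j2 : IntervalIntegrable (fun x : ℝ => x / ε ^ 2) volume 1 ε :=
    (by fun_prop : Continuous fun x : ℝ => x / ε ^ 2).intervalIntegrable _ _
  have i2 : IntegrableOn (fun x : ℝ => 2 * (x⁻¹ - x / ε ^ 2)) (Set.Ioc 1 ε) :=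
    ((j1.sub j2).const_mul 2).1
  rw [← ofReal_integral_eq_lintegral_ofReal i1, ← ofReal_integral_eq_lintegral_ofReal i2,
    ← intervalIntegral.integral_of_le zero_le_one, ← intervalIntegral.integral_of_le hε.le,
    ← ENNReal.ofReal_add]
  · congr 1
    have k1 : ∫ x in (0 : ℝ)..1, 2 * (x - x / ε ^ 2) = 1 - 1 / ε ^ 2 := by
      have j0 : IntervalIntegrable (fun x : ℝ => x) volume 0 1 :=
        continuous_id.intervalIntegrable _ _
      rw [intervalIntegral.integral_const_mul, intervalIntegral.integral_sub j0
        ((by fun_prop : Continuous fun x : ℝ => x / ε ^ 2).intervalIntegrable _ _),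
        intervalIntegral.integral_div, integral_id]
      ring
    have k2 : ∫ x in (1 : ℝ)..ε, 2 * (x⁻¹ - x / ε ^ 2) = 2 * Real.log ε - (1 - 1 / ε ^ 2) := by
      rw [intervalIntegral.integral_const_mul, intervalIntegral.integral_sub j1 j2,
        intervalIntegral.integral_div, integral_id, integral_inv_of_pos one_pos hε0]
      field_simp
    rw [k1, k2]
    ring
  · apply intervalIntegral.integral_nonneg zero_le_one
    intro x hx
    have : x / ε ^ 2 ≤ x := div_le_self hx.1 hε2.le
    linarith
  · apply intervalIntegral.integral_nonneg hε.le
    intro x hx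
    have hx0 : 0 < x := by linarith [hx.1]
    have : x / ε ^ 2 ≤ x⁻¹ := by
      rw [inv_eq_one_div, div_le_div_iff₀ (by positivity) hx0]
      nlinarith [hx.2]
    linarith
  · refine (ae_restrict_iff' measurableSet_Ioc).2 (Eventually.of_forall fun x hx => ?_)
    have hx0 : 0 < x := by linarith [hx.1]
    have : x / ε ^ 2 ≤ x⁻¹ := by
      rw [inv_eq_one_div, div_le_div_iff₀ (by positivity) hx0]
      nlinarith [hx.2]
    simp only [Pi.zero_apply]
    linarith
  · refine (ae_restrict_iff' measurableSet_Ioc).2 (Eventually.of_forall fun x hx => ?_)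
    have : x / ε ^ 2 ≤ x := div_le_self hx.1.le hε2.le
    simp only [Pi.zero_apply]
    linarith

lemma volume_isReducedPair {ε : ℝ} (hε : 1 < ε) :
    volume {p : Fin 2 → ℝ | IsReducedPair ε (p 0) (p 1) ∧ |p 0 * p 1| ≤ 1} =
      ENNReal.ofReal (2 * Real.log ε) := by
  rw [← volume_isReducedPair_prod hε,
    ← (volume_preserving_finTwoArrow ℝ).measure_preimage
      (measurableSet_isReducedPair ε).nullMeasurableSet]
  rfl

lemma volume_eq_zero_of_finite_slices {Z : Set (ℝ × ℝ)} (hZ : MeasurableSet Z)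
    (h : ∀ y : ℝ, {x : ℝ | (x, y) ∈ Z}.Finite) : volume Z = 0 := by
  rw [Measure.volume_eq_prod, Measure.prod_apply_symm hZ]
  have : ∀ y : ℝ, volume ((fun x => (x, y)) ⁻¹' Z) = 0 := fun y => (h y).measure_zero _
  simp [this]

lemma volume_frontier_isReducedPair (ε : ℝ) :
    volume (frontier {p : Fin 2 → ℝ | IsReducedPair ε (p 0) (p 1) ∧ |p 0 * p 1| ≤ 1}) = 0 := by
  let Z : Set (ℝ × ℝ) := {q | 0 = q.1} ∪ {q | |q.2| = q.1} ∪ {q | q.1 = ε ^ 2 * |q.2|} ∪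
    {q | |q.1 * q.2| = 1}
  have hZm : MeasurableSet Z := by
    refine ((MeasurableSet.union ?_ ?_).union ?_).union ?_ <;>
    exact measurableSet_eq_fun (by fun_prop) (by fun_prop)
  have hZ : volume Z = 0 := by
    refine volume_eq_zero_of_finite_slices hZm fun y => ?_
    refine (Set.toFinite {0, |y|, ε ^ 2 * |y|, y⁻¹, -y⁻¹}).subset ?_
    rintro x (((h | h) | h) | h)
    · simp [show (0 : ℝ) = x from h]
    · simp [← show |y| = x from h]
    · simp [show x = ε ^ 2 * |y| from h]
    · have h : |x * y| = 1 := h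
      have hy : y ≠ 0 := by rintro rfl; simp at h
      rcases eq_or_eq_neg_of_abs_eq h with h | h
      · simp [eq_inv_of_mul_eq_one_left h]
      · have : x = -y⁻¹ := by field_simp; linarith
        simp [this]
  have hsub : frontier {p : Fin 2 → ℝ | IsReducedPair ε (p 0) (p 1) ∧ |p 0 * p 1| ≤ 1} ⊆
      MeasurableEquiv.finTwoArrow ⁻¹' Z := by
    have hf : ∀ {s t : Set (Fin 2 → ℝ)}, frontier (s ∩ t) ⊆ frontier s ∪ frontier t := by
      intro s t
      refine (frontier_inter_subset s t).trans (Set.union_subset_union ?_ ?_)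
      exacts [Set.inter_subset_left, Set.inter_subset_right]
    have f1 : frontier {p : Fin 2 → ℝ | 0 < p 0} ⊆ {p | 0 = p 0} :=
      frontier_lt_subset_eq (by fun_prop) (by fun_prop)
    have f2 : frontier {p : Fin 2 → ℝ | |p 1| ≤ p 0} ⊆ {p | |p 1| = p 0} :=
      frontier_le_subset_eq (by fun_prop) (by fun_prop)
    have f3 : frontier {p : Fin 2 → ℝ | p 0 < ε ^ 2 * |p 1|} ⊆ {p | p 0 = ε ^ 2 * |p 1|} :=
      frontier_lt_subset_eq (by fun_prop) (by fun_prop)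
    have f4 : frontier {p : Fin 2 → ℝ | |p 0 * p 1| ≤ 1} ⊆ {p | |p 0 * p 1| = 1} :=
      frontier_le_subset_eq (by fun_prop) (by fun_prop)
    have e : {p : Fin 2 → ℝ | IsReducedPair ε (p 0) (p 1) ∧ |p 0 * p 1| ≤ 1} =
        ({p : Fin 2 → ℝ | 0 < p 0} ∩ {p : Fin 2 → ℝ | |p 1| ≤ p 0} ∩
          {p : Fin 2 → ℝ | p 0 < ε ^ 2 * |p 1|}) ∩ {p : Fin 2 → ℝ | |p 0 * p 1| ≤ 1} := by
      ext p
      simp only [IsReducedPair, Set.mem_ofPred_eq, Set.mem_inter_iff, and_assoc]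
    rw [e]
    exact hf.trans (Set.union_subset_union (hf.trans (Set.union_subset_union
      (hf.trans (Set.union_subset_union f1 f2)) f3)) f4)
  refine measure_mono_null hsub ?_
  rw [(volume_preserving_finTwoArrow ℝ).measure_preimage hZm.nullMeasurableSet, hZ]

lemma IsReducedPair.abs_le {ε x y T : ℝ} (h : IsReducedPair ε x y) (hT : |x * y| ≤ T) :
    |x| ≤ ε ^ 2 * T + 1 ∧ |y| ≤ ε ^ 2 * T + 1 := by
  obtain ⟨hx, hyx, hxe⟩ := h
  rw [abs_mul, abs_of_pos hx] at hT
  have h1 : x ^ 2 ≤ ε ^ 2 * T := by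
    calc x ^ 2 = x * x := sq x
      _ ≤ x * (ε ^ 2 * |y|) := by gcongr
      _ = ε ^ 2 * (x * |y|) := by ring
      _ ≤ ε ^ 2 * T := by gcongr
  have h2 : x ≤ ε ^ 2 * T + 1 := by nlinarith [sq_nonneg (x - 1)]
  rw [abs_of_pos hx]
  exact ⟨h2, hyx.trans h2⟩

lemma finite_reducedLatticePoints {α α' : ℝ} (hδ : 0 < α - α') (ε T : ℝ) :
    (reducedLatticePoints α α' ε T).Finite := by
  set B := ε ^ 2 * T + 1
  set M := 2 * B / (α - α')
  set M' := B + M * |α|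
  refine ((Set.finite_Icc ⌈-M⌉ ⌊M⌋).prod (Set.finite_Icc ⌈-M'⌉ ⌊M'⌋)).subset ?_
  rintro ⟨c, d⟩ ⟨h1, h2⟩
  obtain ⟨h3, h4⟩ := h1.abs_le h2
  dsimp only at h3 h4
  have hc : |(c : ℝ)| ≤ M := by
    rw [le_div_iff₀ hδ, ← abs_of_pos hδ, ← abs_mul]
    calc |(c : ℝ) * (α - α')| = |(c * α + d) - (c * α' + d)| := by ring_nf
      _ ≤ |c * α + d| + |c * α' + d| := abs_sub _ _
      _ ≤ 2 * B := by linarith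
  have hd : |(d : ℝ)| ≤ M' := by
    calc |(d : ℝ)| = |(c * α + d) - c * α| := by ring_nf
      _ ≤ |c * α + d| + |c * α| := abs_sub _ _
      _ ≤ M' := by
        rw [abs_mul]
        exact add_le_add h3 (mul_le_mul_of_nonneg_right hc (abs_nonneg _))
  rw [abs_le] at hc hd
  simp only [Set.mem_prod, Set.mem_Icc, Int.ceil_le, Int.le_floor]
  exact ⟨hc, hd⟩

lemma tendsto_ncard_reducedLatticePoints {α α' ε : ℝ} (hδ : 0 < α - α') (hε : 1 < ε) :
    Tendsto (fun T : ℝ => ((reducedLatticePoints α α' ε T).ncard : ℝ) / T) atTop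
      (𝓝 (2 * Real.log ε / (α - α'))) := by
  have hli : LinearIndependent ℝ ![![α, α'], ![(1 : ℝ), 1]] := by
    rw [LinearIndependent.pair_iff]
    intro a b h
    have h0 := congrFun h 0
    have h1 := congrFun h 1
    simp at h0 h1
    have ha : a * (α - α') = 0 := by linear_combination h0 - h1
    have ha : a = 0 := by simpa [hδ.ne'] using ha
    subst ha
    simpa using h0
  let b : Module.Basis (Fin 2) ℝ (Fin 2 → ℝ) := 
    basisOfLinearIndependentOfCardEqFinrank hli (by simp)
  have hb0 : b 0 = ![α, α'] := by simp [b]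
  have hb1 : b 1 = ![1, 1] := by simp [b]
  let L := Submodule.span ℤ (Set.range b)
  have hcov : ZLattice.covolume L = α - α' := by
    have hb : ∀ i, ((b.restrictScalars ℤ i : L) : Fin 2 → ℝ) = b i :=
      fun i => Module.Basis.restrictScalars_apply ..
    rw [ZLattice.covolume_eq_det L (b.restrictScalars ℤ), Matrix.det_fin_two]
    simp only [Matrix.of_apply, Function.comp_apply, hb, hb0, hb1]
    simp [abs_of_pos hδ]
  have hmain := ZLattice.covolume.tendsto_card_le_div L
    (X := {p : Fin 2 → ℝ | IsReducedPair ε (p 0) (p 1)}) (F := fun p => |p 0 * p 1|)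
    ?_ ?_ ?_ ?_ ?_
  · have hv := volume_isReducedPair hε
    have hv' : volume.real {x ∈ {p : Fin 2 → ℝ | IsReducedPair ε (p 0) (p 1)} |
        |x 0 * x 1| ≤ 1} = 2 * Real.log ε := by
      have h0 : 0 ≤ 2 * Real.log ε := by have := Real.log_pos hε; linarith
      rw [← ENNReal.toReal_ofReal h0, ← hv]
      rfl
    rw [hv', hcov] at hmain
    refine hmain.congr fun T => ?_
    congr 2
    have himg : {x ∈ {p : Fin 2 → ℝ | IsReducedPair ε (p 0) (p 1)} | |x 0 * x 1| ≤ T} ∩ L =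
        (fun p : ℤ × ℤ => ![p.1 * α + p.2, p.1 * α' + p.2]) ''
          reducedLatticePoints α α' ε T := by
      ext x
      constructor
      · rintro ⟨⟨h1, h2⟩, h3⟩
        obtain ⟨f, hf⟩ := (Submodule.mem_span_range_iff_exists_fun ℤ).1 h3
        rw [Fin.sum_univ_two, hb0, hb1] at hf
        have hx : x = ![f 0 * α + f 1, f 0 * α' + f 1] := by
          rw [← hf]; ext i; fin_cases i <;> simp
        refine ⟨(f 0, f 1), ⟨?_, ?_⟩, hx.symm⟩
        · simpa [hx] using h1
        · simpa [hx] using h2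
      · rintro ⟨⟨c, d⟩, ⟨h1, h2⟩, rfl⟩
        refine ⟨⟨by simpa using h1, by simpa using h2⟩, ?_⟩
        refine (Submodule.mem_span_range_iff_exists_fun ℤ).2 ⟨![c, d], ?_⟩
        rw [Fin.sum_univ_two, hb0, hb1]
        ext i; fin_cases i <;> simp
    rw [himg, Nat.card_coe_set_eq]
    apply Set.InjOn.ncard_image
    rintro ⟨c, d⟩ - ⟨c', d'⟩ - h
    have h0 := congrFun h 0
    have h1 := congrFun h 1
    simp only [Matrix.cons_val_zero, Matrix.cons_val_one] at h0 h1
    have hc : ((c : ℝ) - c') * (α - α') = 0 := by linear_combination h0 - h1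
    have hc : (c : ℝ) = c' := by
      rcases mul_eq_zero.1 hc with h | h <;> linarith
    have hd : (d : ℝ) = d' := by rw [hc] at h0; linarith
    exact Prod.ext (by exact_mod_cast hc) (by exact_mod_cast hd)
  · rintro p r ⟨h1, h2, h3⟩ hr
    refine ⟨?_, ?_, ?_⟩
    · simp; positivity
    · simp only [Pi.smul_apply, smul_eq_mul, abs_mul, abs_of_pos hr]; gcongr
    · simp only [Pi.smul_apply, smul_eq_mul, abs_mul, abs_of_pos hr]
      nlinarith
  · intro p r hr
    simp only [Pi.smul_apply, smul_eq_mul, Fintype.card_fin, abs_mul, abs_of_nonneg hr]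
    ring
  · refine (Metric.isBounded_closedBall (x := (0 : Fin 2 → ℝ)) (r := ε ^ 2 * 1 + 1)).subset ?_
    rintro p ⟨h1, h2⟩
    obtain ⟨h3, h4⟩ := IsReducedPair.abs_le h1 h2
    rw [mem_closedBall_zero_iff, pi_norm_le_iff_of_nonneg (by positivity)]
    intro i
    fin_cases i
    · exact h3
    · exact h4
  · exact (MeasurableEquiv.finTwoArrow (α := ℝ)).measurable (measurableSet_isReducedPair ε)
  · exact volume_frontier_isReducedPair ε

end Area

section Asymptotic

open Filter Topology Asymptotics

lemma isReducedPair_const_mul_iff {k : ℝ} (hk : 0 < k) (ε x y : ℝ) :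
    IsReducedPair ε (k * x) (k * y) ↔ IsReducedPair ε x y := by
  simp only [IsReducedPair, abs_mul, abs_of_pos hk, mul_left_comm _ k, mul_pos_iff_of_pos_left hk,
    mul_le_mul_iff_right₀ hk, mul_lt_mul_iff_right₀ hk]

variable {α α' : ℝ} {t n : ℤ}

lemma one_le_abs_norm (hsum : α + α' = t) (hprod : α * α' = n)
    {c d : ℤ} (h : (c * α + d : ℝ) ≠ 0) (h' : (c * α' + d : ℝ) ≠ 0) :
    1 ≤ |(c * α + d) * (c * α' + d)| := by
  have e : (c * α + d) * (c * α' + d) = ((c ^ 2 * n + c * d * t + d ^ 2 : ℤ) : ℝ) := by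
    push_cast; rw [← hsum, ← hprod]; ring
  have hne := mul_ne_zero h h'
  rw [e] at hne ⊢
  exact_mod_cast Int.one_le_abs (by exact_mod_cast hne)

lemma tendsto_ncard_coprime_reducedLatticePoints (hsum : α + α' = t) (hprod : α * α' = n)
    (hδ : 0 < α - α') {ε : ℝ} (hε : 1 < ε) :
    Tendsto (fun T : ℝ =>
      ({p ∈ reducedLatticePoints α α' ε T | IsCoprime p.1 p.2}.ncard : ℝ) / T) atTop
      (𝓝 (6 / π ^ 2 * (2 * Real.log ε / (α - α')))) := by
  refine tendsto_ncard_coprime_div (finite_reducedLatticePoints hδ ε) ?_ ?_ ?_ ?_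
    (tendsto_ncard_reducedLatticePoints hδ hε)
  · rintro T ⟨⟨h, -⟩, -⟩
    simp at h
  · refine fun T hT => Set.eq_empty_of_forall_notMem ?_
    rintro p ⟨⟨h1, h2, h3⟩, h4⟩
    have hy : p.1 * α' + p.2 ≠ 0 := by
      intro h
      rw [h, abs_zero, mul_zero] at h3
      linarith
    linarith [one_le_abs_norm hsum hprod h1.ne' hy]
  · rintro S T hST p ⟨h1, h2⟩
    exact ⟨h1, h2.trans hST⟩
  · intro k p T hk
    have hk' : (0 : ℝ) < k := by exact_mod_cast hk
    have e : ∀ z : ℝ, ((k * p.1 : ℤ) : ℝ) * z + ((k * p.2 : ℤ) : ℝ) = k * (p.1 * z + p.2) := by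
      intro z; push_cast; ring
    simp only [reducedLatticePoints, Set.mem_ofPred_eq, e, isReducedPair_const_mul_iff hk']
    rw [mul_mul_mul_comm, abs_mul, abs_of_pos (mul_pos hk' hk'), le_div_iff₀ (by positivity),
      sq, mul_comm ((k : ℝ) * k)]

lemma finite_mobiusClasses (hα : Irrational α) (hsum : α + α' = t) (hprod : α * α' = n)
    (hδ : 0 < α - α') {c₀ d₀ : ℤ} (h₀ : (c₀ * α + d₀) * (c₀ * α' + d₀) = 1)
    (hε : 1 < c₀ * α + d₀) (s : ℝ) {x : ℝ} (hx : x = α ∨ x = α') :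
    (mobiusClasses α α' s x).Finite := by
  rw [mobiusClasses_eq_image hα hsum hprod hδ h₀ hε s hx]
  exact ((finite_reducedLatticePoints hδ _ _).subset (Set.sep_subset _ _)).image _

lemma tendsto_ncard_mobiusClasses_union (hα : Irrational α) (hsum : α + α' = t)
    (hprod : α * α' = n) (hδ : 0 < α - α') {c₀ d₀ : ℤ}
    (h₀ : (c₀ * α + d₀) * (c₀ * α' + d₀) = 1) (hε : 1 < c₀ * α + d₀)
    (hmin : ∀ c d : ℤ, (c * α + d) * (c * α' + d) = 1 → c ≠ 0 →
      (c₀ * α + d₀) - (c₀ * α + d₀)⁻¹ ≤ |c * (α - α')|) {n₀ : ℕ}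
    (hpos : (∃ c d : ℤ, (c * α + d) * (c * α' + d) = -1) → n₀ = 2)
    (hneg : (¬ ∃ c d : ℤ, (c * α + d) * (c * α' + d) = -1) → n₀ = 1) :
    Tendsto (fun s : ℝ =>
      ((mobiusClasses α α' s α ∪ mobiusClasses α α' s α').ncard : ℝ) / s) atTop
      (𝓝 (24 * Real.log (c₀ * α + d₀) / (π ^ 2 * n₀))) := by
  have hδ' : α - α' ≠ 0 := hδ.ne'
  have hlim := ((tendsto_ncard_coprime_reducedLatticePoints hsum hprod hδ hε).comp
    (tendsto_id.atTop_mul_const hδ)).mul_const ((α - α') * (2 / n₀))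
  have hcount : ∀ s, ((mobiusClasses α α' s α ∪ mobiusClasses α α' s α').ncard : ℝ) =
      2 / n₀ * ({p ∈ reducedLatticePoints α α' (c₀ * α + d₀) (s * (α - α')) |
        IsCoprime p.1 p.2}.ncard : ℝ) := by
    intro s
    by_cases h : ∃ c d : ℤ, (c * α + d) * (c * α' + d) = -1
    · rw [hpos h]
      obtain ⟨c, d, h⟩ := h
      rw [mobiusClasses_conj_eq hα hsum hprod h, Set.union_self,
        ncard_mobiusClasses hα hsum hprod hδ h₀ hε hmin s (Or.inl rfl)]
      simp
    · rw [hneg h, Set.ncard_union_eq (disjoint_mobiusClasses hα hsum hprod h s)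
        (finite_mobiusClasses hα hsum hprod hδ h₀ hε s (Or.inl rfl))
        (finite_mobiusClasses hα hsum hprod hδ h₀ hε s (Or.inr rfl)),
        ncard_mobiusClasses hα hsum hprod hδ h₀ hε hmin s (Or.inl rfl),
        ncard_mobiusClasses hα hsum hprod hδ h₀ hε hmin s (Or.inr rfl)]
      push_cast
      ring
  have hn₀ : (n₀ : ℝ) ≠ 0 := by
    by_cases h : ∃ c d : ℤ, (c * α + d) * (c * α' + d) = -1
    · simp [hpos h]
    · simp [hneg h]
  convert hlim.congr' ?_ using 2
  · field_simp
    ring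
  · filter_upwards [eventually_ne_atTop 0] with s hs
    rw [hcount]
    simp only [Function.comp_apply, id]
    field_simp

lemma pell_parity {D t₀ u₀ : ℤ} (hD : D = t ^ 2 - 4 * n) (hPell : t₀ ^ 2 - D * u₀ ^ 2 = 4) :
    ∃ d₀, t₀ = 2 * d₀ + u₀ * t := by
  have h : Even ((t₀ - u₀ * t) * (t₀ + u₀ * t)) :=
    ⟨2 - 2 * n * u₀ ^ 2, by rw [hD] at hPell; linear_combination hPell⟩
  have h2 : Even (t₀ - u₀ * t) := by
    rcases Int.even_mul.1 h with h | h
    · exact h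
    · have : t₀ - u₀ * t = (t₀ + u₀ * t) - 2 * (u₀ * t) := by ring
      rw [this]
      exact h.sub (even_two_mul _)
  obtain ⟨d, hd⟩ := h2
  exact ⟨d, by linarith⟩

lemma isEquivalent_ncard_mobius_of_lt (hα : Irrational α) (hsum : α + α' = t)
    (hprod : α * α' = n) (hlt : α' < α) {D t₀ u₀ : ℤ} (hD : D = t ^ 2 - 4 * n)
    (hu₀ : 0 < u₀) (ht₀ : 0 < t₀) (hPell : t₀ ^ 2 - D * u₀ ^ 2 = 4)
    (hmin : ∀ t' u' : ℤ, 0 < t' → 0 < u' → t' ^ 2 - D * u' ^ 2 = 4 → u₀ ≤ u') {n₀ : ℕ}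
    (hpos : (∃ c d : ℤ, (c * α + d) * (c * α' + d) = -1) → n₀ = 2)
    (hneg : (¬ ∃ c d : ℤ, (c * α + d) * (c * α' + d) = -1) → n₀ = 1) :
    IsEquivalent atTop
      (fun s : ℝ => (((fun a : ℝ => (a : AddCircle (1 : ℝ))) ''
        {a : ℝ | ∃ g : SL2Z, (a = mobius g α ∨ a = mobius g α') ∧
          |mobius g α - mobius g α'|⁻¹ ≤ s}).ncard : ℝ))
      (fun s : ℝ => 24 * Real.log ((t₀ + u₀ * √D) / 2) / (π ^ 2 * n₀) * s) := by
  have hδ : 0 < α - α' := sub_pos.2 hlt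
  have hDδ : (D : ℝ) = (α - α') ^ 2 := by
    rw [hD]; push_cast; rw [← hsum, ← hprod]; ring
  obtain ⟨d₀, hd₀⟩ := pell_parity hD hPell
  have hsqrt : √(D : ℝ) = α - α' := by rw [hDδ, Real.sqrt_sq hδ.le]
  have ht₀' : (t₀ : ℝ) = 2 * d₀ + u₀ * t := by exact_mod_cast hd₀
  have hPell' : (t₀ : ℝ) ^ 2 - (α - α') ^ 2 * u₀ ^ 2 = 4 := by
    rw [← hDδ]; exact_mod_cast hPell
  have e1 : u₀ * α + d₀ = (t₀ + u₀ * (α - α')) / 2 := by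
    rw [ht₀', ← hsum]; ring
  have e2 : u₀ * α' + d₀ = (t₀ - u₀ * (α - α')) / 2 := by
    rw [ht₀', ← hsum]; ring
  have h₀ : (u₀ * α + d₀) * (u₀ * α' + d₀) = 1 := by
    rw [e1, e2]; linarith
  have hu₀' : (0 : ℝ) < u₀ := by exact_mod_cast hu₀
  have ht₀0 : (0 : ℝ) < t₀ := by exact_mod_cast ht₀
  have hu₀δ : 0 < u₀ * (α - α') := mul_pos hu₀' hδ
  have hε : 1 < u₀ * α + d₀ := by
    rw [e1]; nlinarith
  have hunit : ∀ c d : ℤ, (c * α + d) * (c * α' + d) = 1 → c ≠ 0 →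
      (u₀ * α + d₀) - (u₀ * α + d₀)⁻¹ ≤ |c * (α - α')| := by
    intro c d h hc
    rw [inv_eq_of_mul_eq_one_right h₀, abs_mul, abs_of_pos hδ]
    have hpell : (2 * d + c * t) ^ 2 - D * c ^ 2 = 4 := by
      have : (2 * (d : ℝ) + c * t) ^ 2 - D * c ^ 2 = 4 := by
        rw [hDδ, ← hsum]; linear_combination 4 * h
      exact_mod_cast this
    have hD0 : 0 < D := by
      have : (0 : ℝ) < D := by rw [hDδ]; positivity
      exact_mod_cast this
    have hne : 2 * d + c * t ≠ 0 := by
      intro h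
      rw [h] at hpell
      nlinarith [sq_nonneg c]
    have hle := hmin |2 * d + c * t| |c| (abs_pos.2 hne) (abs_pos.2 hc)
      (by rw [sq_abs, sq_abs]; exact hpell)
    have hle' : (u₀ : ℝ) ≤ |(c : ℝ)| := by exact_mod_cast hle
    nlinarith
  have hlim := tendsto_ncard_mobiusClasses_union hα hsum hprod hδ h₀ hε hunit hpos hneg
  simp only [image_eq_mobiusClasses_union, hsqrt, ← e1]
  have hn₀ : (0 : ℝ) < n₀ := by
    by_cases h : ∃ c d : ℤ, (c * α + d) * (c * α' + d) = -1
    · simp [hpos h]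
    · simp [hneg h]
  have hlog := Real.log_pos hε
  set C := 24 * Real.log (u₀ * α + d₀) / (π ^ 2 * n₀)
  have hC : 0 < C := by positivity
  rw [isEquivalent_iff_tendsto_one]
  · have := hlim.div_const C
    rw [div_self hC.ne'] at this
    refine this.congr fun s => ?_
    rw [Pi.div_apply, div_div, mul_comm s C]
  · filter_upwards [eventually_ne_atTop 0] with s hs
    exact mul_ne_zero hC.ne' hs

end Asymptotic

/-- Corollary 1.4 of the paper. Let `α₀` be a real quadratic irrational which is an algebraic
integer: `α₀` irrational, `α₀² = t α₀ - n` with `t = Tr(α₀), n = N(α₀) ∈ ℤ`, Galois conjugate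
`α₀^σ = t - α₀`. Let `D = Tr(α₀)² - 4 N(α₀)` be the discriminant of the order
`𝒪 = ℤ + α₀ℤ`, let `(t₀, u₀)` be the fundamental solution of `t² - D u² = 4` (with
`t₀, u₀ > 0` and `u₀` minimal), `ε₀ = (t₀ + u₀ √D)/2`, `R₀ = log ε₀`, and let `n₀ = 2` if `𝒪`
contains a unit of norm `-1` (an element `u + v α₀` with
`(u + v α₀)(u + v α₀^σ) = -1`), and `n₀ = 1` otherwise. Then, as `s → +∞`, the number of
classes modulo translation by `ℤ` of elements `α` of `PSL₂(ℤ)·{α₀, α₀^σ}` with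
`|α - α^σ|⁻¹ ≤ s` is asymptotically equivalent to `(24 R₀ / (π² n₀)) · s`. -/
theorem stmt11 (α₀ : ℝ) (hα₀ : Irrational α₀) (t n : ℤ)
    (hquad : α₀ ^ 2 = (t : ℝ) * α₀ - (n : ℝ))
    (D : ℤ) (hD : D = t ^ 2 - 4 * n)
    (t₀ u₀ : ℤ) (ht₀ : 0 < t₀) (hu₀ : 0 < u₀) (hPell : t₀ ^ 2 - D * u₀ ^ 2 = 4)
    (hmin : ∀ t' u' : ℤ, 0 < t' → 0 < u' → t' ^ 2 - D * u' ^ 2 = 4 → u₀ ≤ u')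
    (n₀ : ℕ)
    (hn₀pos : (∃ u v : ℤ, ((u : ℝ) + (v : ℝ) * α₀) *
        ((u : ℝ) + (v : ℝ) * ((t : ℝ) - α₀)) = -1) → n₀ = 2)
    (hn₀neg : ¬ (∃ u v : ℤ, ((u : ℝ) + (v : ℝ) * α₀) *
        ((u : ℝ) + (v : ℝ) * ((t : ℝ) - α₀)) = -1) → n₀ = 1) :
    Asymptotics.IsEquivalent Filter.atTop
      (fun s : ℝ => (Set.ncard
        ((fun α : ℝ => (α : AddCircle ((1 : ℝ)))) ''
          {α : ℝ | ∃ g : SL2Z, (α = mobius g α₀ ∨ α = mobius g ((t : ℝ) - α₀)) ∧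
            (|mobius g α₀ - mobius g ((t : ℝ) - α₀)|)⁻¹ ≤ s}) : ℝ))
      (fun s : ℝ =>
        24 * Real.log (((t₀ : ℝ) + (u₀ : ℝ) * Real.sqrt ((D : ℝ))) / 2) /
          (π ^ 2 * (n₀ : ℝ)) * s) := by
  have hsum : α₀ + ((t : ℝ) - α₀) = t := by ring
  have hprod : α₀ * ((t : ℝ) - α₀) = n := by linear_combination -hquad
  have hnorm : ∀ c d : ℤ, ((c : ℝ) * α₀ + d) * (c * ((t : ℝ) - α₀) + d) =
      ((d : ℝ) + c * α₀) * (d + c * ((t : ℝ) - α₀)) := fun c d => by ring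
  have hunit : (∃ c d : ℤ, ((c : ℝ) * α₀ + d) * (c * ((t : ℝ) - α₀) + d) = -1) ↔
      ∃ u v : ℤ, ((u : ℝ) + (v : ℝ) * α₀) * ((u : ℝ) + (v : ℝ) * ((t : ℝ) - α₀)) = -1 := by
    simp only [hnorm]
    exact exists_comm
  rw [← hunit] at hn₀pos hn₀neg
  have hα₀' := irrational_conj hα₀ hsum
  generalize (t : ℝ) - α₀ = α₀' at *
  rcases lt_trichotomy α₀' α₀ with h | h | h
  · exact isEquivalent_ncard_mobius_of_lt hα₀ hsum hprod h hD hu₀ ht₀ hPell hmin hn₀pos hn₀neg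
  · subst h
    have : ((2 : ℤ) : ℝ) * α₀' + ((-t : ℤ) : ℝ) = 0 := by push_cast; linarith
    simpa using (eq_zero_of_irrational hα₀ this).1
  · have hswap : ∀ c d : ℤ, ((c : ℝ) * α₀' + d) * (c * α₀ + d) = (c * α₀ + d) * (c * α₀' + d) :=
      fun c d => mul_comm _ _
    have := isEquivalent_ncard_mobius_of_lt hα₀' (by rwa [add_comm]) (by rwa [mul_comm]) h hD
      hu₀ ht₀ hPell hmin (n₀ := n₀) (by simpa only [hswap] using hn₀pos)
      (by simpa only [hswap] using hn₀neg)
    simpa only [abs_sub_comm (mobius _ α₀') (mobius _ α₀), or_comm (b := _ = mobius _ α₀)]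
      using this
end

section
/- Let Q be an integral binary quadratic form which is indefinite with non-square discriminant D_Q. Let D' be the quotient of D_Q by the square of the gcd of the coefficients of Q, let (t_Q, u_Q) be the fundamental solution of the Pell equation t² − D' u² = 4 (t_Q, u_Q > 0, u_Q minimal), ε_Q = (t_Q + u_Q√D')/2 and R_Q = log ε_Q. Let Ψ_Q(s) be the number of orbits of SO(Q,ℤ) on the set of pairs (x,y) of coprime integers with |Q(x,y)| ≤ s. Then Ψ_Q(s) ∼ (12 R_Q / (π² √D_Q)) · s as s → +∞. -/
open scoped Real

/-- The value `Q(x, y) = A x² + B x y + C y²` of the integral binary quadratic form with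
coefficients `(A, B, C)` on the pair `x = (x₁, x₂)`. -/
def Qval (A B C : ℤ) (x : ℤ × ℤ) : ℤ := A * x.1 ^ 2 + B * x.1 * x.2 + C * x.2 ^ 2

/-- The linear action of `SL(2,ℤ)` on `ℤ²`. -/
def actPair (g : SL2Z) (x : ℤ × ℤ) : ℤ × ℤ :=
  (g.1 0 0 * x.1 + g.1 0 1 * x.2, g.1 1 0 * x.1 + g.1 1 1 * x.2)

/-- The right action of `SL(2,ℤ)` on binary quadratic forms,
`(Q ∘ γ)(X, Y) = Q(aX + bY, cX + dY)`, on the coefficients `(A, B, C)`; the automorph group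
`SO(Q, ℤ)` is the set of `γ ∈ SL₂(ℤ)` with `Q ∘ γ = Q`. -/
def formComp (A B C : ℤ) (g : SL2Z) : ℤ × ℤ × ℤ :=
  (A * (g.1 0 0) ^ 2 + B * (g.1 0 0) * (g.1 1 0) + C * (g.1 1 0) ^ 2,
   2 * A * (g.1 0 0) * (g.1 0 1) + B * ((g.1 0 0) * (g.1 1 1) + (g.1 0 1) * (g.1 1 0))
     + 2 * C * (g.1 1 0) * (g.1 1 1),
   A * (g.1 0 1) ^ 2 + B * (g.1 0 1) * (g.1 1 1) + C * (g.1 1 1) ^ 2)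

/-- `Ψ_Q(s)`: the number of orbits of `SO(Q,ℤ)` on the set of pairs of coprime integers
`(x, y)` with `|Q(x, y)| ≤ s` (the quotient of this set by the generating relation
`x ∼ γ·x`, `γ ∈ SO(Q,ℤ)`, whose equivalence closure is the orbit relation). -/
noncomputable def Psi (A B C : ℤ) (s : ℝ) : ℕ :=
  Nat.card (Quot (fun x y :
      {x : ℤ × ℤ // IsCoprime x.1 x.2 ∧ ((|Qval A B C x| : ℤ) : ℝ) ≤ s} =>
    ∃ g : SL2Z, formComp A B C g = (A, B, C) ∧ (y : ℤ × ℤ) = actPair g (x : ℤ × ℤ)))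

section PrimitivePointCount

open MeasureTheory Set

/-- The truncated hyperbolic sector
`{(u, v) | 0 < u, |v| ≤ u < e² |v|, |u v| ≤ 1}`. -/
def hyperbolicSector (e : ℝ) : Set (ℝ × ℝ) :=
  {p | (0 < p.1 ∧ |p.2| ≤ p.1 ∧ p.1 < e ^ 2 * |p.2|) ∧ |p.1 * p.2| ≤ 1}

lemma measurableSet_hyperbolicSector (e : ℝ) : MeasurableSet (hyperbolicSector e) := by
  have h1 : Measurable fun p : ℝ × ℝ => |p.2| := measurable_snd.abs
  have h2 : Measurable fun p : ℝ × ℝ => |p.1 * p.2| := (measurable_fst.mul measurable_snd).abs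
  exact ((measurableSet_lt measurable_const measurable_fst).inter
    ((measurableSet_le h1 measurable_fst).inter
      (measurableSet_lt measurable_fst (h1.const_mul _)))).inter
    (measurableSet_le h2 measurable_const)

lemma volume_setOf_lt_abs_le {p m : ℝ} (hp : 0 ≤ p) :
    volume {v : ℝ | p < |v| ∧ |v| ≤ m} = ENNReal.ofReal (2 * (m - p)) := by
  rcases le_or_gt p m with hpm | hpm
  · have : {v : ℝ | p < |v| ∧ |v| ≤ m} = Icc (-m) m \ Icc (-p) p := by
      ext v
      simp only [mem_ofPred_eq, mem_sdiff, mem_Icc, ← abs_le, not_le]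
      exact and_comm
    rw [this, measure_sdiff (Icc_subset_Icc (by linarith) hpm) nullMeasurableSet_Icc (by simp),
      Real.volume_Icc, Real.volume_Icc, ← ENNReal.ofReal_sub _ (by linarith)]
    congr 1
    ring
  · rw [ENNReal.ofReal_of_nonpos (by linarith)]
    convert measure_empty (μ := volume)
    ext v
    simp only [mem_ofPred_eq, mem_empty_iff_false, iff_false]
    intro h
    linarith [h.1, h.2]

lemma volume_hyperbolicSector_fiber {e u : ℝ} (he : 1 < e) (hu : 0 < u) :
    volume (Prod.mk u ⁻¹' hyperbolicSector e) =
      ENNReal.ofReal (2 * (min u u⁻¹ - u / e ^ 2)) := by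
  have he2 : 0 < e ^ 2 := by positivity
  rw [← volume_setOf_lt_abs_le (by positivity)]
  congr 1
  ext v
  have h1 : |u * v| ≤ 1 ↔ |v| ≤ u⁻¹ := by
    rw [abs_mul, abs_of_pos hu, ← one_div, le_div_iff₀' hu]
  have h2 : u < e ^ 2 * |v| ↔ u / e ^ 2 < |v| := by rw [div_lt_iff₀' he2]
  simp only [hyperbolicSector, mem_preimage, mem_ofPred_eq, hu, true_and, h1, h2, le_min_iff]
  tauto

lemma volume_hyperbolicSector {e : ℝ} (he : 1 < e) :
    volume (hyperbolicSector e) = ENNReal.ofReal (2 * Real.log e) := by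
  have he0 : 0 < e := by linarith
  have hfib : ∀ u, volume (Prod.mk u ⁻¹' hyperbolicSector e) =
      (Ioc 0 e).indicator (fun u => ENNReal.ofReal (2 * (min u u⁻¹ - u / e ^ 2))) u := by
    intro u
    by_cases hu : 0 < u
    · rw [volume_hyperbolicSector_fiber he hu]
      by_cases hue : u ≤ e
      · rw [indicator_of_mem (by exact ⟨hu, hue⟩)]
      · rw [indicator_of_notMem (by simp [hue])]
        apply ENNReal.ofReal_of_nonpos
        have h1 : u⁻¹ ≤ u / e ^ 2 := by
          rw [inv_le_iff_one_le_mul₀ hu, div_mul_eq_mul_div, le_div_iff₀ (by positivity)]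
          nlinarith
        linarith [min_le_right u u⁻¹]
    · rw [indicator_of_notMem (by simp [hu])]
      convert measure_empty (μ := volume)
      ext v
      simp [hyperbolicSector, hu]
  have hnonneg : ∀ u ∈ Ioc 0 e, 0 ≤ 2 * (min u u⁻¹ - u / e ^ 2) := by
    intro u hu
    have h1 : u / e ^ 2 ≤ u := div_le_self hu.1.le (by nlinarith)
    have h2 : u / e ^ 2 ≤ u⁻¹ := by
      rw [← one_div, div_le_div_iff₀ (by positivity) hu.1]
      nlinarith [hu.1, hu.2]
    linarith [le_min h1 h2]
  have eq1 : EqOn (fun u : ℝ => 2 * (min u u⁻¹ - u / e ^ 2))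
      (fun u => 2 * (1 - 1 / e ^ 2) * u) (uIcc 0 1) := by
    intro u hu
    rw [uIcc_of_le zero_le_one] at hu
    have : min u u⁻¹ = u := by
      refine min_eq_left ?_
      rcases hu.1.eq_or_lt with h | h
      · simp [← h]
      · exact hu.2.trans ((one_le_inv₀ h).2 hu.2)
    simp only [this]
    ring
  have eq2 : EqOn (fun u : ℝ => 2 * (min u u⁻¹ - u / e ^ 2))
      (fun u => 2 * u⁻¹ - 2 / e ^ 2 * u) (uIcc 1 e) := by
    intro u hu
    rw [uIcc_of_le he.le] at hu
    have : min u u⁻¹ = u⁻¹ := min_eq_right ((inv_le_one_of_one_le₀ hu.1).trans hu.1)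
    simp only [this]
    ring
  have h0 : (0 : ℝ) ∉ uIcc 1 e := by
    rw [uIcc_of_le he.le]
    simp
  have hinv : ContinuousOn (fun u : ℝ => u⁻¹) (uIcc 1 e) :=
    continuousOn_id.inv₀ fun x hx h => h0 (h ▸ hx)
  have hc1 : IntervalIntegrable (fun u : ℝ => 2 * (min u u⁻¹ - u / e ^ 2)) volume 0 1 :=
    ((continuous_const.mul continuous_id).continuousOn.congr eq1).intervalIntegrable
  have hc2 : IntervalIntegrable (fun u : ℝ => 2 * (min u u⁻¹ - u / e ^ 2)) volume 1 e :=
    (((hinv.const_mul 2).sub (continuous_const.mul continuous_id).continuousOn).congr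
      eq2).intervalIntegrable
  rw [Measure.volume_eq_prod, Measure.prod_apply (measurableSet_hyperbolicSector e)]
  simp_rw [hfib]
  rw [lintegral_indicator measurableSet_Ioc, ← ofReal_integral_eq_lintegral_ofReal]
  · congr 1
    rw [← intervalIntegral.integral_of_le he0.le,
      ← intervalIntegral.integral_add_adjacent_intervals (b := 1) hc1 hc2,
      intervalIntegral.integral_congr eq1, intervalIntegral.integral_congr eq2,
      intervalIntegral.integral_sub, intervalIntegral.integral_const_mul,
      intervalIntegral.integral_const_mul, intervalIntegral.integral_const_mul,
      integral_id, integral_id,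
      integral_inv h0]
    · rw [div_one]
      field_simp
      ring
    · exact hinv.intervalIntegrable.const_mul _
    · exact (continuous_const.mul continuous_id).intervalIntegrable _ _
  · exact (intervalIntegrable_iff_integrableOn_Ioc_of_le he0.le).1 (hc1.trans hc2)
  · filter_upwards [ae_restrict_mem measurableSet_Ioc] with u hu using hnonneg u hu

lemma volume_frontier_hyperbolicSector {e : ℝ} (he : 1 < e) :
    volume (frontier (hyperbolicSector e)) = 0 := by
  have he2 : 0 < e ^ 2 := by positivity
  have hsub : frontier (hyperbolicSector e) ⊆
      {p : ℝ × ℝ | 0 = p.1} ∪ ({p | |p.2| = p.1} ∪ {p | p.1 = e ^ 2 * |p.2|})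
        ∪ {p | |p.1 * p.2| = 1} := by
    have c1 : Continuous fun p : ℝ × ℝ => |p.2| := continuous_snd.abs
    have c2 : Continuous fun p : ℝ × ℝ => |p.1 * p.2| := (continuous_fst.mul continuous_snd).abs
    refine (frontier_inter_subset _ _).trans (union_subset_union
      (inter_subset_left.trans ((frontier_inter_subset _ _).trans (union_subset_union
        (inter_subset_left.trans (frontier_lt_subset_eq continuous_const continuous_fst))
        (inter_subset_right.trans ((frontier_inter_subset _ _).trans (union_subset_union
          (inter_subset_left.trans (frontier_le_subset_eq c1 continuous_fst))
          (inter_subset_right.trans (frontier_lt_subset_eq continuous_fst (c1.const_mul _)))))))))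
      (inter_subset_right.trans (frontier_le_subset_eq c2 continuous_const)))
  refine measure_mono_null hsub ?_
  rw [Measure.volume_eq_prod, Measure.measure_prod_null]
  · have : ∀ᵐ u : ℝ, u ≠ 0 := by simp [ae_iff]
    filter_upwards [this] with u hu
    apply Set.Finite.measure_zero
    refine Set.Finite.subset (s := {u, -u, u / e ^ 2, - (u / e ^ 2), u⁻¹, -u⁻¹})
      (by simp) ?_
    intro v hv
    simp only [preimage_union, preimage_ofPred_eq, mem_union, mem_ofPred_eq, hu.symm,
      false_or] at hv
    simp only [mem_insert_iff, mem_singleton_iff]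
    rcases hv with (hv | hv) | hv
    · rcases eq_or_eq_neg_of_abs_eq hv with h | h <;> tauto
    · have hv' : |v| = u / e ^ 2 := by rw [hv]; field_simp
      rcases eq_or_eq_neg_of_abs_eq hv' with h | h <;> tauto
    · rcases eq_or_eq_neg_of_abs_eq hv with h | h
      · have := eq_inv_of_mul_eq_one_right h
        tauto
      · have : v = -u⁻¹ := by field_simp; linarith
        tauto
  · have h1 : Measurable fun p : ℝ × ℝ => |p.2| := measurable_snd.abs
    have h2 : Measurable fun p : ℝ × ℝ => |p.1 * p.2| := (measurable_fst.mul measurable_snd).abs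
    exact ((measurableSet_eq_fun measurable_const measurable_fst).union
      ((measurableSet_eq_fun h1 measurable_fst).union
        (measurableSet_eq_fun measurable_fst (h1.const_mul _)))).union
      (measurableSet_eq_fun h2 measurable_const)

open Filter Topology

/-- The cone underlying `hyperbolicSector e`: `{(u, v) | 0 < u, |v| ≤ u < e² |v|}`. -/
def sectorCone (e : ℝ) : Set (ℝ × ℝ) :=
  {p | 0 < p.1 ∧ |p.2| ≤ p.1 ∧ p.1 < e ^ 2 * |p.2|}

lemma smul_mem_sectorCone {e r : ℝ} (hr : 0 < r) {p : ℝ × ℝ} :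
    r • p ∈ sectorCone e ↔ p ∈ sectorCone e := by
  simp only [sectorCone, mem_ofPred_eq, Prod.smul_fst, Prod.smul_snd, smul_eq_mul, abs_mul,
    abs_of_pos hr, mul_pos_iff_of_pos_left hr, mul_le_mul_iff_right₀ hr]
  rw [mul_left_comm, mul_lt_mul_iff_right₀ hr]

/-- The pair of linear forms `(x, y) ↦ (α x + β y, γ x + δ y)` with real coefficients. -/
def linPair (M : Matrix (Fin 2) (Fin 2) ℝ) (x y : ℝ) : ℝ × ℝ :=
  (M 0 0 * x + M 0 1 * y, M 1 0 * x + M 1 1 * y)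

lemma smul_linPair (M : Matrix (Fin 2) (Fin 2) ℝ) (r x y : ℝ) :
    linPair M (r * x) (r * y) = r • linPair M x y := by
  ext <;> simp [linPair] <;> ring

lemma hyperbolicSector_bound {e : ℝ} (he : 1 < e) {p : ℝ × ℝ} (hp : p ∈ sectorCone e) :
    |p.1| ^ 2 ≤ e ^ 2 * |p.1 * p.2| ∧ |p.2| ^ 2 ≤ e ^ 2 * |p.1 * p.2| := by
  obtain ⟨h1, h2, h3⟩ := hp
  have h0 := abs_nonneg p.2
  have he2 : 1 < e ^ 2 := by nlinarith
  rw [abs_mul, abs_of_pos h1]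
  constructor
  · nlinarith
  · have : |p.2| ^ 2 ≤ p.1 * |p.2| := by nlinarith
    nlinarith [mul_nonneg h1.le h0]

lemma det_mul_eq_linPair (M : Matrix (Fin 2) (Fin 2) ℝ) (x y : ℝ) :
    M.det * x = M 1 1 * (linPair M x y).1 - M 0 1 * (linPair M x y).2 ∧
      M.det * y = M 0 0 * (linPair M x y).2 - M 1 0 * (linPair M x y).1 := by
  rw [Matrix.det_fin_two, linPair]
  constructor <;> ring

lemma exists_bound_of_linPair_mem_sectorCone {e : ℝ} (he : 1 < e)
    {M : Matrix (Fin 2) (Fin 2) ℝ} (hM : M.det ≠ 0) (s : ℝ) :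
    ∃ K : ℝ, ∀ x y : ℝ, linPair M x y ∈ sectorCone e →
      |(linPair M x y).1 * (linPair M x y).2| ≤ s → |x| ≤ K ∧ |y| ≤ K := by
  set B := Real.sqrt (e ^ 2 * s)
  refine ⟨(|M 0 0| + |M 0 1| + |M 1 0| + |M 1 1|) * B / |M.det|, fun x y hx hs => ?_⟩
  obtain ⟨h1, h2⟩ := hyperbolicSector_bound he hx
  have he2 : 0 < e ^ 2 := by positivity
  have b1 : |(linPair M x y).1| ≤ B := Real.le_sqrt_of_sq_le (h1.trans (by gcongr))
  have b2 : |(linPair M x y).2| ≤ B := Real.le_sqrt_of_sq_le (h2.trans (by gcongr))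
  obtain ⟨d1, d2⟩ := det_mul_eq_linPair M x y
  have hB : 0 ≤ B := Real.sqrt_nonneg _
  have hd : 0 < |M.det| := abs_pos.2 hM
  have key : ∀ a b u v : ℝ, |u| ≤ B → |v| ≤ B → |a * u - b * v| ≤ (|a| + |b|) * B := by
    intro a b u v hu hv
    refine (abs_sub _ _).trans ?_
    rw [abs_mul, abs_mul, add_mul]
    gcongr
  rw [le_div_iff₀ hd, le_div_iff₀ hd, ← abs_mul, ← abs_mul, mul_comm x, mul_comm y, d1, d2]
  constructor
  · refine (key _ _ _ _ b1 b2).trans ?_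
    exact mul_le_mul_of_nonneg_right (by linarith [abs_nonneg (M 0 0), abs_nonneg (M 1 0)]) hB
  · refine (key _ _ _ _ b2 b1).trans ?_
    exact mul_le_mul_of_nonneg_right (by linarith [abs_nonneg (M 0 1), abs_nonneg (M 1 1)]) hB

lemma volume_preimage_linPair {M : Matrix (Fin 2) (Fin 2) ℝ} (hM : M.det ≠ 0)
    {S : Set (ℝ × ℝ)} (hS : MeasurableSet S) :
    volume ((fun x : Fin 2 → ℝ => linPair M (x 0) (x 1)) ⁻¹' S) =
      ENNReal.ofReal |M.det⁻¹| * volume S := by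
  have hdet : LinearMap.det (Matrix.toLin' M) ≠ 0 := by rwa [LinearMap.det_toLin']
  have h := Measure.addHaar_preimage_linearMap volume hdet
    (MeasurableEquiv.finTwoArrow (α := ℝ) ⁻¹' S)
  rw [(volume_preserving_finTwoArrow ℝ).measure_preimage hS.nullMeasurableSet,
    LinearMap.det_toLin'] at h
  rw [← h]
  congr 1
  ext x
  simp [linPair, MeasurableEquiv.finTwoArrow]

/-- The number of integral points in a dilated hyperbolic sector is asymptotic to its area. -/
theorem tendsto_card_linPair_mem_sector {e : ℝ} (he : 1 < e) {M : Matrix (Fin 2) (Fin 2) ℝ}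
    (hM : M.det ≠ 0) :
    Tendsto (fun s : ℝ => (Nat.card {x : ℤ × ℤ | linPair M x.1 x.2 ∈ sectorCone e ∧
      |(linPair M x.1 x.2).1 * (linPair M x.1 x.2).2| ≤ s} : ℝ) / s) atTop
      (𝓝 (2 * Real.log e / |M.det|)) := by
  have hcont : Continuous fun x : Fin 2 → ℝ => linPair M (x 0) (x 1) := by
    unfold linPair
    fun_prop
  have hpre : {x | x ∈ {x : Fin 2 → ℝ | linPair M (x 0) (x 1) ∈ sectorCone e} ∧
      |(linPair M (x 0) (x 1)).1 * (linPair M (x 0) (x 1)).2| ≤ 1} =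
      (fun x : Fin 2 → ℝ => linPair M (x 0) (x 1)) ⁻¹' hyperbolicSector e := rfl
  have hcov : ZLattice.covolume
      (Submodule.span ℤ (range (Pi.basisFun ℝ (Fin 2)))) = 1 := by
    rw [ZLattice.covolume_eq_measure_fundamentalDomain _ volume
      (ZSpan.isAddFundamentalDomain (Pi.basisFun ℝ (Fin 2)) volume),
      ZSpan.volume_real_fundamentalDomain]
    have : Matrix.of (Pi.basisFun ℝ (Fin 2)) = 1 := by
      ext i j
      simp [Matrix.one_apply, Pi.single_apply, eq_comm]
    rw [this]
    simp
  have := ZLattice.covolume.tendsto_card_le_div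
    (Submodule.span ℤ (range (Pi.basisFun ℝ (Fin 2))))
    (X := {x : Fin 2 → ℝ | linPair M (x 0) (x 1) ∈ sectorCone e})
    (F := fun x => |(linPair M (x 0) (x 1)).1 * (linPair M (x 0) (x 1)).2|)
    (fun x r hx hr => by
      simpa [smul_linPair, smul_mem_sectorCone hr] using hx)
    (fun x r hr => by
      simp only [Pi.smul_apply, smul_eq_mul, smul_linPair, Prod.smul_fst, Prod.smul_snd,
        Fintype.card_fin, abs_mul, abs_of_nonneg hr]
      ring)
    (by
      obtain ⟨K, hK⟩ := exists_bound_of_linPair_mem_sectorCone he hM 1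
      refine Bornology.IsBounded.subset (Metric.isBounded_closedBall (x := 0) (r := max K 0)) ?_
      intro x hx
      obtain ⟨h1, h2⟩ := hK _ _ hx.1 hx.2
      rw [mem_closedBall_zero_iff, pi_norm_le_iff_of_nonneg (le_max_right _ _)]
      intro i
      fin_cases i
      · exact h1.trans (le_max_left _ _)
      · exact h2.trans (le_max_left _ _))
    (by
      rw [hpre]
      exact hcont.measurable (measurableSet_hyperbolicSector e))
    (by
      rw [hpre]
      refine measure_mono_null (hcont.frontier_preimage_subset _) ?_
      rw [volume_preimage_linPair hM isClosed_frontier.measurableSet,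
        volume_frontier_hyperbolicSector he, mul_zero])
  rw [hpre, hcov, measureReal_def, volume_preimage_linPair hM (measurableSet_hyperbolicSector e),
    volume_hyperbolicSector he, ENNReal.toReal_mul, ENNReal.toReal_ofReal (abs_nonneg _),
    ENNReal.toReal_ofReal (by have := Real.log_pos he; positivity), div_one, abs_inv,
    ← div_eq_inv_mul] at this
  refine this.congr fun s => ?_
  congr 2
  symm
  have hinj : Function.Injective fun x : ℤ × ℤ => (![(x.1 : ℝ), (x.2 : ℝ)] : Fin 2 → ℝ) := by
    intro x y hxy
    have h0 := congrFun hxy 0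
    have h1 := congrFun hxy 1
    simp only [Matrix.cons_val_zero, Matrix.cons_val_one, Int.cast_inj] at h0 h1
    exact Prod.ext h0 h1
  rw [← Nat.card_image_of_injective hinj]
  congr 2
  ext x
  simp only [mem_image, mem_inter_iff, SetLike.mem_coe, Module.Basis.mem_span_iff_repr_mem,
    Pi.basisFun_repr, mem_range, mem_ofPred_eq]
  constructor
  · rintro ⟨y, hy, rfl⟩
    refine ⟨by simpa using hy, fun i => ?_⟩
    fin_cases i
    · exact ⟨y.1, by simp⟩
    · exact ⟨y.2, by simp⟩
  · rintro ⟨hx, hi⟩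
    obtain ⟨m, hm⟩ := hi 0
    obtain ⟨n, hn⟩ := hi 1
    simp only [algebraMap_int_eq, eq_intCast] at hm hn
    refine ⟨(m, n), by simpa [hm, hn] using hx, ?_⟩
    ext i
    fin_cases i <;> simp [hm, hn]

lemma finite_linPair_mem_sector {e : ℝ} (he : 1 < e) {M : Matrix (Fin 2) (Fin 2) ℝ}
    (hM : M.det ≠ 0) (s : ℝ) :
    {x : ℤ × ℤ | linPair M x.1 x.2 ∈ sectorCone e ∧
      |(linPair M x.1 x.2).1 * (linPair M x.1 x.2).2| ≤ s}.Finite := by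
  obtain ⟨K, hK⟩ := exists_bound_of_linPair_mem_sectorCone he hM s
  refine ((finite_Icc (-⌊K⌋) ⌊K⌋).prod (finite_Icc (-⌊K⌋) ⌊K⌋)).subset fun x hx => ?_
  obtain ⟨h1, h2⟩ := hK _ _ hx.1 hx.2
  rw [mem_prod, mem_Icc, mem_Icc, ← abs_le, ← abs_le, Int.le_floor, Int.le_floor]
  exact_mod_cast And.intro h1 h2

open ArithmeticFunction ArithmeticFunction.Moebius in
lemma hasSum_moebius_div_sq : HasSum (fun d : ℕ => (μ d : ℝ) / d ^ 2) (6 / π ^ 2) := by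
  have h2 : (1 : ℝ) < (2 : ℂ).re := by norm_num
  have hs : LSeriesSummable (fun n => (μ n : ℂ)) 2 :=
    ArithmeticFunction.LSeriesSummable_moebius_iff.2 h2
  have h := hs.hasSum
  have hval : ∑' n, LSeries.term (fun n => (μ n : ℂ)) 2 n = ((6 / π ^ 2 : ℝ) : ℂ) := by
    have h1 := ArithmeticFunction.LSeries_zeta_mul_Lseries_moebius h2
    rw [ArithmeticFunction.LSeries_zeta_eq_riemannZeta h2, riemannZeta_two] at h1
    change (π : ℂ) ^ 2 / 6 * ∑' n, LSeries.term (fun n => (μ n : ℂ)) 2 n = 1 at h1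
    have hpi : (π : ℂ) ≠ 0 := by exact_mod_cast Real.pi_ne_zero
    push_cast
    rw [eq_div_iff (by positivity)]
    field_simp at h1
    linear_combination h1
  rw [hval] at h
  rw [← Complex.hasSum_ofReal]
  refine h.congr_fun fun n => ?_
  rcases eq_or_ne n 0 with rfl | hn
  · simp
  · rw [LSeries.term_of_ne_zero hn]
    push_cast
    congr 1
    exact_mod_cast Complex.cpow_natCast (n : ℂ) 2

open ArithmeticFunction ArithmeticFunction.Moebius in
lemma sum_divisors_moebius (n : ℕ) : ∑ d ∈ n.divisors, (μ d : ℝ) = if n = 1 then 1 else 0 := by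
  have h : ∑ d ∈ n.divisors, μ d = if n = 1 then 1 else 0 := by
    rw [← coe_mul_zeta_apply, moebius_mul_coe_zeta, one_apply]
  exact_mod_cast congrArg (Int.cast : ℤ → ℝ) h

open ArithmeticFunction ArithmeticFunction.Moebius in
/-- Möbius inversion over the content of an integral vector. -/
lemma card_coprime_eq_sum_moebius {T : Set (ℤ × ℤ)} (hT : T.Finite) (h0 : (0, 0) ∉ T) :
    (Nat.card {x | x ∈ T ∧ IsCoprime x.1 x.2} : ℝ) =
      ∑' d : ℕ, (μ d : ℝ) * (Nat.card {x : ℤ × ℤ | ((d * x.1, d * x.2) : ℤ × ℤ) ∈ T} : ℝ) := by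
  classical
  set S := hT.toFinset
  set K := S.sup fun x => Int.gcd x.1 x.2
  have hgcd : ∀ x ∈ S, Int.gcd x.1 x.2 ≠ 0 := by
    intro x hx h
    rw [Int.gcd_eq_zero_iff] at h
    exact h0 (by simpa [S, show x = (0, 0) from Prod.ext h.1 h.2] using hx)
  have hK : ∀ x ∈ S, Int.gcd x.1 x.2 ≤ K := fun x hx =>
    Finset.le_sup (f := fun x : ℤ × ℤ => Int.gcd x.1 x.2) hx
  have hN : ∀ d : ℕ, d ≠ 0 → Nat.card {x : ℤ × ℤ | ((d * x.1, d * x.2) : ℤ × ℤ) ∈ T} =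
      (S.filter fun x => d ∣ Int.gcd x.1 x.2).card := by
    intro d hd
    have hd' : (d : ℤ) ≠ 0 := by exact_mod_cast hd
    have hinj : Function.Injective fun x : ℤ × ℤ => ((d * x.1, d * x.2) : ℤ × ℤ) := by
      intro x y hxy
      simp only [Prod.mk.injEq, mul_eq_mul_left_iff, hd', or_false] at hxy
      exact Prod.ext hxy.1 hxy.2
    rw [← Nat.card_image_of_injective hinj, Nat.card_coe_set_eq, ← Set.ncard_coe_finset]
    congr 1
    ext x
    simp only [mem_image, mem_ofPred_eq, Finset.coe_filter, S, Finite.mem_toFinset]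
    constructor
    · rintro ⟨y, hy, rfl⟩
      exact ⟨hy, Int.dvd_gcd (dvd_mul_right _ _) (dvd_mul_right _ _)⟩
    · rintro ⟨hx, hd⟩
      obtain ⟨m, hm⟩ := (Int.natCast_dvd_natCast.2 hd).trans (Int.gcd_dvd_left x.1 x.2)
      obtain ⟨n, hn⟩ := (Int.natCast_dvd_natCast.2 hd).trans (Int.gcd_dvd_right x.1 x.2)
      have hxy : ((d * m, d * n) : ℤ × ℤ) = x := Prod.ext hm.symm hn.symm
      exact ⟨(m, n), hxy.symm ▸ hx, hxy⟩
  have hP : Nat.card {x | x ∈ T ∧ IsCoprime x.1 x.2} =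
      (S.filter fun x => Int.gcd x.1 x.2 = 1).card := by
    rw [← Nat.card_eq_finsetCard]
    congr 2
    ext x
    simp [S, Int.isCoprime_iff_gcd_eq_one]
  rw [tsum_eq_sum (s := Finset.Icc 1 K)]
  · rw [hP, Finset.card_filter]
    push_cast
    calc ∑ x ∈ S, (if Int.gcd x.1 x.2 = 1 then (1 : ℝ) else 0)
        = ∑ x ∈ S, ∑ d ∈ Finset.Icc 1 K, if d ∣ Int.gcd x.1 x.2 then (μ d : ℝ) else 0 := by
          refine Finset.sum_congr rfl fun x hx => ?_
          rw [← sum_divisors_moebius, ← Finset.sum_filter]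
          refine Finset.sum_congr ?_ fun _ _ => rfl
          ext d
          simp only [Nat.mem_divisors, Finset.mem_filter, Finset.mem_Icc]
          constructor
          · rintro ⟨h1, h2⟩
            exact ⟨⟨Nat.pos_of_dvd_of_pos h1 (Nat.pos_of_ne_zero h2),
              (Nat.le_of_dvd (Nat.pos_of_ne_zero h2) h1).trans (hK x hx)⟩, h1⟩
          · rintro ⟨-, h⟩
            exact ⟨h, hgcd x hx⟩
      _ = _ := by
          rw [Finset.sum_comm]
          refine Finset.sum_congr rfl fun d hd => ?_
          rw [hN d (by have := (Finset.mem_Icc.1 hd).1; omega), Finset.card_filter]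
          push_cast
          rw [Finset.mul_sum]
          exact Finset.sum_congr rfl fun x _ => by split_ifs <;> simp
  · intro d hd
    rcases eq_or_ne d 0 with rfl | hd0
    · simp
    · rw [hN d hd0, Finset.card_eq_zero.2, Nat.cast_zero, mul_zero]
      refine Finset.filter_eq_empty_iff.2 fun x hx hdvd => hd ?_
      have := Nat.le_of_dvd (Nat.pos_of_ne_zero (hgcd x hx)) hdvd
      exact Finset.mem_Icc.2 ⟨Nat.pos_of_ne_zero hd0, this.trans (hK x hx)⟩

open ArithmeticFunction ArithmeticFunction.Moebius in
/-- Passing from all integral points to primitive ones multiplies the density by `6 / π²`. -/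
theorem tendsto_card_coprime {T : ℝ → Set (ℤ × ℤ)} (hfin : ∀ s, (T s).Finite)
    (hmono : Monotone T) (hempty : ∀ s < 1, T s = ∅)
    (h0 : ∀ s, (0, 0) ∉ T s)
    (hscale : ∀ d : ℕ, d ≠ 0 → ∀ s,
      {x : ℤ × ℤ | ((d * x.1, d * x.2) : ℤ × ℤ) ∈ T s} = T (s / d ^ 2))
    {κ : ℝ} (hlim : Tendsto (fun s => (Nat.card (T s) : ℝ) / s) atTop (𝓝 κ)) :
    Tendsto (fun s => (Nat.card {x | x ∈ T s ∧ IsCoprime x.1 x.2} : ℝ) / s) atTop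
      (𝓝 (κ * (6 / π ^ 2))) := by
  obtain ⟨C, hC⟩ : ∃ C : ℝ, ∀ s, 0 < s → (Nat.card (T s) : ℝ) / s ≤ C := by
    obtain ⟨s₀, hs₀⟩ := eventually_atTop.1 (hlim.eventually_le_const (lt_add_one κ))
    refine ⟨max (κ + 1) (Nat.card (T s₀)), fun s hs => ?_⟩
    rcases le_or_gt s₀ s with h | h
    · exact (hs₀ s h).trans (le_max_left _ _)
    · refine le_max_of_le_right ?_
      rcases lt_or_ge s 1 with h1 | h1
      · simp [hempty s h1]
      · refine (div_le_self (by positivity) h1).trans ?_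
        exact_mod_cast Nat.card_mono (hfin s₀) (hmono h.le)
  have hC0 : 0 ≤ C := le_trans (by positivity) (hC 1 one_pos)
  have hsum := hasSum_moebius_div_sq
  have hP : ∀ s : ℝ, (Nat.card {x | x ∈ T s ∧ IsCoprime x.1 x.2} : ℝ) / s =
      ∑' d : ℕ, (μ d : ℝ) * ((Nat.card (T (s / d ^ 2)) : ℝ) / s) := by
    intro s
    rw [card_coprime_eq_sum_moebius (hfin s) (h0 s), ← tsum_div_const]
    refine tsum_congr fun d => ?_
    rcases eq_or_ne d 0 with rfl | hd
    · simp
    · rw [hscale d hd, mul_div_assoc]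
  rw [← hsum.tsum_eq, ← tsum_mul_left]
  refine Tendsto.congr (fun s => (hP s).symm) ?_
  refine tendsto_tsum_of_dominated_convergence (bound := fun d : ℕ => C * (1 / (d : ℝ) ^ 2))
    ((Real.summable_one_div_nat_pow.2 one_lt_two).mul_left C) ?_ ?_
  · intro d
    rcases eq_or_ne d 0 with rfl | hd
    · simp
    have hd' : (0 : ℝ) < (d : ℝ) ^ 2 := by positivity
    have := ((hlim.comp (tendsto_id.atTop_div_const hd')).const_mul ((μ d : ℝ) / d ^ 2))
    rw [mul_comm] at this
    refine this.congr fun s => ?_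
    simp only [Function.comp, id]
    field_simp
  · filter_upwards [eventually_gt_atTop 0] with s hs d
    rcases eq_or_ne d 0 with rfl | hd
    · simp
    have hd' : (0 : ℝ) < (d : ℝ) ^ 2 := by positivity
    rw [norm_mul]
    have h1 : ‖(μ d : ℝ)‖ ≤ 1 := by
      rw [Real.norm_eq_abs]
      exact_mod_cast abs_moebius_le_one
    have h2 : ‖(Nat.card (T (s / d ^ 2)) : ℝ) / s‖ ≤ C * (1 / (d : ℝ) ^ 2) := by
      rw [Real.norm_of_nonneg (by positivity)]
      have := hC (s / d ^ 2) (by positivity)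
      rw [div_le_iff₀ (by positivity)] at this ⊢
      refine this.trans_eq ?_
      ring
    calc _ ≤ 1 * (C * (1 / (d : ℝ) ^ 2)) := by gcongr
      _ = _ := one_mul _

lemma formComp_mul (A B C : ℤ) (g h : SL2Z) :
    formComp A B C (g * h) =
      formComp (formComp A B C g).1 (formComp A B C g).2.1 (formComp A B C g).2.2 h := by
  simp only [formComp, Matrix.SpecialLinearGroup.coe_mul, Matrix.mul_apply, Fin.sum_univ_two,
    Prod.mk.injEq]
  refine ⟨?_, ?_, ?_⟩ <;> ring

lemma formComp_one (A B C : ℤ) : formComp A B C 1 = (A, B, C) := by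
  simp [formComp]

lemma actPair_mul (g h : SL2Z) (x : ℤ × ℤ) : actPair (g * h) x = actPair g (actPair h x) := by
  simp only [actPair, Matrix.SpecialLinearGroup.coe_mul, Matrix.mul_apply, Fin.sum_univ_two,
    Prod.mk.injEq]
  refine ⟨?_, ?_⟩ <;> ring

lemma actPair_one (x : ℤ × ℤ) : actPair 1 x = x := by
  simp [actPair]

lemma Qval_actPair (A B C : ℤ) (g : SL2Z) (x : ℤ × ℤ) :
    Qval A B C (actPair g x) =
      Qval (formComp A B C g).1 (formComp A B C g).2.1 (formComp A B C g).2.2 x := by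
  simp only [Qval, actPair, formComp]
  ring

lemma isCoprime_actPair (g : SL2Z) {x : ℤ × ℤ} (hx : IsCoprime x.1 x.2) :
    IsCoprime (actPair g x).1 (actPair g x).2 := by
  obtain ⟨m, n, h⟩ := hx
  have hdet := g.2
  rw [Matrix.det_fin_two] at hdet
  refine ⟨m * g.1 1 1 - n * g.1 1 0, -m * g.1 0 1 + n * g.1 0 0, ?_⟩
  simp only [actPair]
  linear_combination (m * x.1 + n * x.2) * hdet + h

/-- The automorphs of a form constitute a subgroup of `SL(2, ℤ)`. -/
def automorphGroup (A B C : ℤ) : Subgroup SL2Z where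
  carrier := {g | formComp A B C g = (A, B, C)}
  one_mem' := formComp_one A B C
  mul_mem' := by
    intro g h hg hh
    simp only [mem_ofPred_eq] at hg hh ⊢
    rw [formComp_mul, hg, hh]
  inv_mem' := by
    intro g hg
    simp only [mem_ofPred_eq] at hg ⊢
    have h := formComp_mul A B C g g⁻¹
    rw [mul_inv_cancel, formComp_one, hg] at h
    exact h.symm

lemma mem_automorphGroup {A B C : ℤ} {g : SL2Z} :
    g ∈ automorphGroup A B C ↔ formComp A B C g = (A, B, C) := Iff.rfl

lemma automorphGroup_mul_left {k : ℤ} (hk : k ≠ 0) (a b c : ℤ) :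
    automorphGroup (k * a) (k * b) (k * c) = automorphGroup a b c := by
  ext g
  have : formComp (k * a) (k * b) (k * c) g = (k * (formComp a b c g).1,
      k * (formComp a b c g).2.1, k * (formComp a b c g).2.2) := by
    simp only [formComp, Prod.mk.injEq]
    refine ⟨?_, ?_, ?_⟩ <;> ring
  rw [mem_automorphGroup, mem_automorphGroup, this]
  simp [Prod.ext_iff, hk]

/-- The matrix of the two linear factors of `4 a (a x² + b x y + c y²)`, where `δ² = b² - 4 a c`. -/
def factorMatrix (a b : ℤ) (δ : ℝ) : Matrix (Fin 2) (Fin 2) ℝ :=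
  !![2 * a, b + δ; 2 * a, b - δ]

lemma det_factorMatrix (a b : ℤ) (δ : ℝ) : (factorMatrix a b δ).det = -(4 * a * δ) := by
  rw [factorMatrix, Matrix.det_fin_two_of]
  ring

lemma linPair_factorMatrix (a b : ℤ) (δ x y : ℝ) :
    linPair (factorMatrix a b δ) x y = (2 * a * x + (b + δ) * y, 2 * a * x + (b - δ) * y) := rfl

lemma linPair_factorMatrix_mul {a b c : ℤ} {δ : ℝ} (hδ : δ ^ 2 = (b ^ 2 - 4 * a * c : ℤ))
    (x : ℤ × ℤ) :
    (linPair (factorMatrix a b δ) x.1 x.2).1 * (linPair (factorMatrix a b δ) x.1 x.2).2 =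
      4 * a * (Qval a b c x : ℤ) := by
  rw [linPair_factorMatrix, Qval]
  push_cast at hδ ⊢
  linear_combination (-(x.2 : ℝ) ^ 2) * hδ

/-- A solution of the Pell equation `t² - (b² - 4 a c) w² = 4` gives an automorph. -/
lemma exists_automorph_of_pell {a b c t w : ℤ} {δ : ℝ}
    (hδ : δ ^ 2 = (b ^ 2 - 4 * a * c : ℤ)) (h : t ^ 2 - (b ^ 2 - 4 * a * c) * w ^ 2 = 4) :
    ∃ g ∈ automorphGroup a b c, ∀ x : ℤ × ℤ,
      linPair (factorMatrix a b δ) (actPair g x).1 (actPair g x).2 =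
        ((t + w * δ) / 2 * (linPair (factorMatrix a b δ) x.1 x.2).1,
          (t - w * δ) / 2 * (linPair (factorMatrix a b δ) x.1 x.2).2) := by
  obtain ⟨p, hp⟩ : (2 : ℤ) ∣ t - b * w := by
    have h4 : (2 : ℤ) ∣ (t - b * w) * (t - b * w) :=
      ⟨2 - 2 * a * c * w ^ 2 + b ^ 2 * w ^ 2 - b * t * w, by linear_combination h⟩
    exact (Int.prime_two.dvd_or_dvd h4).elim id id
  obtain rfl : t = 2 * p + b * w := by linarith
  have hdet : (!![p, -c * w; a * w, p + b * w] : Matrix (Fin 2) (Fin 2) ℤ).det = 1 := by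
    rw [Matrix.det_fin_two_of]
    linarith
  obtain ⟨g, hg⟩ : ∃ g : SL2Z, g.1 = !![p, -c * w; a * w, p + b * w] := ⟨⟨_, hdet⟩, rfl⟩
  refine ⟨g, ?_, fun x => ?_⟩
  · rw [Matrix.det_fin_two_of] at hdet
    simp only [mem_automorphGroup, formComp, hg, Matrix.of_apply, Matrix.cons_val',
      Matrix.cons_val_zero, Matrix.cons_val_one, Matrix.cons_val_fin_one, Prod.mk.injEq]
    refine ⟨?_, ?_, ?_⟩
    · linear_combination a * hdet
    · linear_combination b * hdet
    · linear_combination c * hdet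
  · simp only [actPair, hg, linPair_factorMatrix, Matrix.of_apply, Matrix.cons_val',
      Matrix.cons_val_zero, Matrix.cons_val_one, Matrix.cons_val_fin_one, Prod.mk.injEq]
    push_cast at hδ ⊢
    constructor
    · linear_combination (-(w : ℝ) * x.2 / 2) * hδ
    · linear_combination (-(w : ℝ) * x.2 / 2) * hδ

/-- Every automorph of a primitive form comes from a solution of the Pell equation. -/
lemma exists_pell_of_automorph {a b c : ℤ} {δ : ℝ} (ha : a ≠ 0)
    (hprim : Int.gcd a (Int.gcd b c) = 1)
    (hδ : δ ^ 2 = (b ^ 2 - 4 * a * c : ℤ)) {g : SL2Z} (hg : g ∈ automorphGroup a b c) :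
    ∃ t w : ℤ, t ^ 2 - (b ^ 2 - 4 * a * c) * w ^ 2 = 4 ∧ ∀ x : ℤ × ℤ,
      linPair (factorMatrix a b δ) (actPair g x).1 (actPair g x).2 =
        ((t + w * δ) / 2 * (linPair (factorMatrix a b δ) x.1 x.2).1,
          (t - w * δ) / 2 * (linPair (factorMatrix a b δ) x.1 x.2).2) := by
  have hdet := g.2
  rw [Matrix.det_fin_two] at hdet
  simp only [mem_automorphGroup, formComp, Prod.mk.injEq] at hg
  simp only [actPair]
  set p := g.1 0 0
  set q := g.1 0 1
  set r := g.1 1 0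
  set s := g.1 1 1
  obtain ⟨e1, e2, e3⟩ := hg
  have f1 : a * (s - p) = b * r := by
    have : 2 * (a * (s - p)) = 2 * (b * r) := by
      linear_combination -2 * s * e1 + r * e2 + (2 * a * p + b * r) * hdet
    linarith
  have f2 : a * q = -(c * r) := by
    have : 2 * (a * q) = 2 * -(c * r) := by
      linear_combination s * e2 - 2 * r * e3 - (2 * a * q + b * s) * hdet
    linarith
  have hdvd : a ∣ r := by
    have h1 : a ∣ (Int.gcd b c : ℤ) * r := by
      rw [Int.gcd_eq_gcd_ab, add_mul]
      refine dvd_add ?_ ?_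
      · exact ⟨(s - p) * Int.gcdA b c, by linear_combination (-Int.gcdA b c) * f1⟩
      · exact ⟨- q * Int.gcdB b c, by linear_combination (Int.gcdB b c) * f2⟩
    exact (Int.isCoprime_iff_gcd_eq_one.2 hprim).dvd_of_dvd_mul_left h1
  obtain ⟨w, hw⟩ := hdvd
  have f3 : s - p = b * w := mul_left_cancel₀ ha (by rw [f1, hw]; ring)
  have f4 : q = -(c * w) := mul_left_cancel₀ ha (by rw [f2, hw]; ring)
  obtain hs : s = p + b * w := by linarith
  rw [hw, f4, hs] at hdet
  refine ⟨p + s, w, ?_, fun x => ?_⟩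
  · rw [hs]
    linear_combination 4 * hdet
  · rw [hw, f4, hs]
    simp only [linPair_factorMatrix, Prod.mk.injEq]
    push_cast at hδ ⊢
    constructor
    · linear_combination (-(w : ℝ) * x.2 / 2) * hδ
    · linear_combination (-(w : ℝ) * x.2 / 2) * hδ

lemma Qval_ne_zero {a b c : ℤ} (hnsq : ¬ IsSquare (b ^ 2 - 4 * a * c)) {x : ℤ × ℤ} (hx : x ≠ 0) :
    Qval a b c x ≠ 0 := by
  intro h
  have ha : a ≠ 0 := by
    rintro rfl
    exact hnsq ⟨b, by ring⟩
  have hsq : (b ^ 2 - 4 * a * c) * x.2 ^ 2 = (2 * a * x.1 + b * x.2) ^ 2 := by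
    rw [Qval] at h
    linear_combination -4 * a * h
  have hdvd : x.2 ∣ 2 * a * x.1 + b * x.2 :=
    (Int.pow_dvd_pow_iff two_ne_zero).1 ⟨_, by rw [← hsq, mul_comm]⟩
  obtain ⟨m, hm⟩ := hdvd
  rcases eq_or_ne x.2 0 with h2 | h2
  · have h1 : x.1 = 0 := by
      simpa [Qval, h2, ha] using h
    exact hx (Prod.ext h1 h2)
  · refine hnsq ⟨m, mul_right_cancel₀ (pow_ne_zero 2 h2) ?_⟩
    rw [hsq, hm]
    ring

lemma one_lt_of_pell {D t u : ℤ} (hD : 0 < D) (ht : 0 < t) (hu : 0 < u)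
    (h : t ^ 2 - D * u ^ 2 = 4) : 1 < ((t : ℝ) + u * √D) / 2 := by
  have h2 : 2 < t := by
    have : 0 < D * u ^ 2 := by positivity
    nlinarith
  have h2' : (2 : ℝ) < t := by exact_mod_cast h2
  have hu' : (0 : ℝ) < u := by exact_mod_cast hu
  have : 0 ≤ u * √(D : ℝ) := by positivity
  linarith

lemma pell_le_of_le {D t u t' u' : ℤ} (hD : 0 < D) (ht' : 0 < t') (hu : 0 < u)
    (h : t ^ 2 - D * u ^ 2 = 4) (h' : t' ^ 2 - D * u' ^ 2 = 4) (huu : u ≤ u') :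
    ((t : ℝ) + u * √D) / 2 ≤ ((t' : ℝ) + u' * √D) / 2 := by
  have htt : t ≤ t' := by
    refine (le_abs_self t).trans ((sq_le_sq.1 ?_).trans_eq (abs_of_pos ht'))
    have : u ^ 2 ≤ u' ^ 2 := pow_le_pow_left₀ hu.le huu 2
    nlinarith
  have h1 : (t : ℝ) ≤ t' := by exact_mod_cast htt
  have h2 : (u : ℝ) ≤ u' := by exact_mod_cast huu
  gcongr

/-- Two points of the cone differing by a hyperbolic rotation `(α, β)`, `α β = 1`, whose
dilation factor is at least `e` cannot exist. -/
lemma not_mem_sectorCone_of_le {e α β : ℝ} (he : 1 < e) (hαβ : α * β = 1) (hα : e ≤ α)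
    {p : ℝ × ℝ} (hp : p ∈ sectorCone e) : (α * p.1, β * p.2) ∉ sectorCone e := by
  rintro ⟨-, -, h3⟩
  obtain ⟨h1, h2, -⟩ := hp
  simp only at h3
  have hα0 : 0 < α := by linarith
  have hβ0 : 0 < β := pos_of_mul_pos_right (by rw [hαβ]; exact one_pos) hα0.le
  rw [abs_mul, abs_of_pos hβ0] at h3
  have h4 : α * (α * p.1) < α * (e ^ 2 * (β * |p.2|)) := mul_lt_mul_of_pos_left h3 hα0
  have h5 : α * (e ^ 2 * (β * |p.2|)) = e ^ 2 * |p.2| := by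
    linear_combination (e ^ 2 * |p.2|) * hαβ
  have h6 : e ^ 2 ≤ α ^ 2 := by gcongr
  nlinarith [mul_le_mul_of_nonneg_left h2 (sq_nonneg e), mul_le_mul_of_nonneg_right h6 h1.le]

lemma eq_of_pell_of_mem_sectorCone {D t u : ℤ} (hD : 0 < D) (ht : 0 < t) (hu : 0 < u)
    (h : t ^ 2 - D * u ^ 2 = 4)
    (hmin : ∀ t' u' : ℤ, 0 < t' → 0 < u' → t' ^ 2 - D * u' ^ 2 = 4 → u ≤ u')
    {t' w : ℤ} (h' : t' ^ 2 - D * w ^ 2 = 4) {p q : ℝ × ℝ}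
    (hp : p ∈ sectorCone (((t : ℝ) + u * √D) / 2))
    (hq : q ∈ sectorCone (((t : ℝ) + u * √D) / 2))
    (hpq : q = ((t' + w * √D) / 2 * p.1, (t' - w * √D) / 2 * p.2)) : q = p := by
  have he := one_lt_of_pell hD ht hu h
  have hD' : √(D : ℝ) ^ 2 = D := Real.sq_sqrt (by exact_mod_cast hD.le)
  have hR : (t' : ℝ) ^ 2 - D * w ^ 2 = 4 := by exact_mod_cast h'
  have hαβ : (t' + w * √D) / 2 * ((t' - w * √D) / 2) = 1 := by
    linear_combination (1 / 4 : ℝ) * hR - (w : ℝ) ^ 2 / 4 * hD'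
  have hα : 0 < (t' + w * √D) / 2 := by
    have := hq.1
    rw [hpq] at this
    exact pos_of_mul_pos_left this hp.1.le
  have hβ : 0 < (t' - w * √D) / 2 := pos_of_mul_pos_right (by rw [hαβ]; exact one_pos) hα.le
  have ht' : 0 < t' := by
    have : (0 : ℝ) < t' := by linarith
    exact_mod_cast this
  rcases lt_trichotomy w 0 with hw | rfl | hw
  · exfalso
    have hle := pell_le_of_le hD ht' hu h (u' := -w) (by linear_combination h')
      (hmin t' (-w) ht' (by omega) (by linear_combination h'))
    refine not_mem_sectorCone_of_le he (α := (t' - w * √D) / 2) (β := (t' + w * √D) / 2)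
      (by rw [mul_comm, hαβ]) (hle.trans_eq (by push_cast; ring)) hq ?_
    convert hp using 1
    rw [hpq]
    ext
    · linear_combination p.1 * hαβ
    · linear_combination p.2 * hαβ
  · have : t' = 2 := by nlinarith
    rw [hpq, this]
    simp
  · exfalso
    refine not_mem_sectorCone_of_le he hαβ
      (pell_le_of_le hD ht' hu h h' (hmin t' w ht' hw h')) hp ?_
    rw [← hpq]
    exact hq

lemma linPair_injective {M : Matrix (Fin 2) (Fin 2) ℝ} (hM : M.det ≠ 0) {x y : ℤ × ℤ}
    (h : linPair M x.1 x.2 = linPair M y.1 y.2) : x = y := by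
  obtain ⟨h1, h2⟩ := det_mul_eq_linPair M x.1 x.2
  obtain ⟨h3, h4⟩ := det_mul_eq_linPair M y.1 y.2
  rw [h, ← h3] at h1
  rw [h, ← h4] at h2
  exact Prod.ext (by exact_mod_cast mul_left_cancel₀ hM h1)
    (by exact_mod_cast mul_left_cancel₀ hM h2)

/-- All integral powers of the hyperbolic rotation attached to a Pell solution are realised by
automorphs. -/
lemma exists_automorph_zpow {a b c t w : ℤ} {δ : ℝ}
    (hδ : δ ^ 2 = (b ^ 2 - 4 * a * c : ℤ)) (h : t ^ 2 - (b ^ 2 - 4 * a * c) * w ^ 2 = 4) (n : ℤ) :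
    ∃ g ∈ automorphGroup a b c, ∀ x : ℤ × ℤ,
      linPair (factorMatrix a b δ) (actPair g x).1 (actPair g x).2 =
        (((t + w * δ) / 2) ^ n * (linPair (factorMatrix a b δ) x.1 x.2).1,
          ((t - w * δ) / 2) ^ n * (linPair (factorMatrix a b δ) x.1 x.2).2) := by
  have hR : (t : ℝ) ^ 2 - ((b ^ 2 - 4 * a * c : ℤ) : ℝ) * w ^ 2 = 4 := by exact_mod_cast h
  have hαβ : (t + w * δ) / 2 * ((t - w * δ) / 2) = 1 := by
    linear_combination (1 / 4 : ℝ) * hR - (w : ℝ) ^ 2 / 4 * hδ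
  have hα : (t + w * δ) / 2 ≠ 0 := left_ne_zero_of_mul_eq_one hαβ
  have hβ : (t - w * δ) / 2 ≠ 0 := right_ne_zero_of_mul_eq_one hαβ
  obtain ⟨g₁, hg₁, hg₁'⟩ := exists_automorph_of_pell hδ h
  obtain ⟨g₂, hg₂, hg₂'⟩ := exists_automorph_of_pell (t := t) (w := -w) hδ (by linear_combination h)
  have hβ' : (t + ((-w : ℤ) : ℝ) * δ) / 2 = ((t + w * δ) / 2)⁻¹ := by
    rw [← eq_inv_of_mul_eq_one_right hαβ]
    push_cast
    ring
  have hα' : (t - ((-w : ℤ) : ℝ) * δ) / 2 = ((t - w * δ) / 2)⁻¹ := by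
    rw [← eq_inv_of_mul_eq_one_left hαβ]
    push_cast
    ring
  induction n with
  | zero => exact ⟨1, one_mem _, fun x => by simp [actPair_one]⟩
  | succ n ih =>
    obtain ⟨g, hg, hg'⟩ := ih
    refine ⟨g₁ * g, mul_mem hg₁ hg, fun x => ?_⟩
    rw [actPair_mul, hg₁', hg', zpow_add_one₀ hα, zpow_add_one₀ hβ]
    ext <;> ring
  | pred n ih =>
    obtain ⟨g, hg, hg'⟩ := ih
    refine ⟨g₂ * g, mul_mem hg₂ hg, fun x => ?_⟩
    rw [actPair_mul, hg₂', hg', zpow_sub_one₀ hα, zpow_sub_one₀ hβ, hα', hβ']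
    ext <;> ring

lemma neg_one_mem_automorphGroup (a b c : ℤ) : -1 ∈ automorphGroup a b c := by
  simp [mem_automorphGroup, formComp]

lemma actPair_neg_one (x : ℤ × ℤ) : actPair (-1) x = -x := by
  simp [actPair, Prod.ext_iff]

/-- Every orbit meets the cone. -/
lemma exists_automorph_mem_sectorCone {a b c t u : ℤ} (hD : 0 < b ^ 2 - 4 * a * c)
    (hnsq : ¬ IsSquare (b ^ 2 - 4 * a * c)) (ht : 0 < t) (hu : 0 < u)
    (h : t ^ 2 - (b ^ 2 - 4 * a * c) * u ^ 2 = 4) {x : ℤ × ℤ} (hx : x ≠ 0) :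
    ∃ g ∈ automorphGroup a b c,
      linPair (factorMatrix a b √((b ^ 2 - 4 * a * c : ℤ) : ℝ)) (actPair g x).1 (actPair g x).2 ∈
        sectorCone (((t : ℝ) + u * √((b ^ 2 - 4 * a * c : ℤ) : ℝ)) / 2) := by
  have he := one_lt_of_pell hD ht hu h
  have hδ : √((b ^ 2 - 4 * a * c : ℤ) : ℝ) ^ 2 = (b ^ 2 - 4 * a * c : ℤ) :=
    Real.sq_sqrt (by exact_mod_cast hD.le)
  have ha : (a : ℝ) ≠ 0 := by
    norm_cast
    rintro rfl
    exact hnsq ⟨b, by ring⟩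
  wlog hpos : 0 < (linPair (factorMatrix a b √((b ^ 2 - 4 * a * c : ℤ) : ℝ)) x.1 x.2).1
    generalizing x
  · have hneg : linPair (factorMatrix a b √((b ^ 2 - 4 * a * c : ℤ) : ℝ))
        ((-x).1 : ℤ) ((-x).2 : ℤ) =
        - linPair (factorMatrix a b √((b ^ 2 - 4 * a * c : ℤ) : ℝ)) x.1 x.2 := by
      rw [← neg_one_smul ℝ (linPair _ _ _), ← smul_linPair]
      simp
    have hne : (linPair (factorMatrix a b √((b ^ 2 - 4 * a * c : ℤ) : ℝ)) x.1 x.2).1 ≠ 0 := by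
      refine left_ne_zero_of_mul
        (b := (linPair (factorMatrix a b √((b ^ 2 - 4 * a * c : ℤ) : ℝ)) x.1 x.2).2) ?_
      rw [linPair_factorMatrix_mul hδ]
      have : ((Qval a b c x : ℤ) : ℝ) ≠ 0 := by exact_mod_cast Qval_ne_zero hnsq hx
      positivity
    obtain ⟨g, hg, hg'⟩ := this (x := -x) (neg_ne_zero.2 hx) (by
      rw [hneg, Prod.fst_neg, neg_pos]
      exact lt_of_le_of_ne (not_lt.1 hpos) hne)
    refine ⟨g * -1, mul_mem hg (neg_one_mem_automorphGroup a b c), ?_⟩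
    rwa [actPair_mul, actPair_neg_one]
  have hne : 0 < |(linPair (factorMatrix a b √((b ^ 2 - 4 * a * c : ℤ) : ℝ)) x.1 x.2).2| := by
    refine abs_pos.2 (right_ne_zero_of_mul
      (a := (linPair (factorMatrix a b √((b ^ 2 - 4 * a * c : ℤ) : ℝ)) x.1 x.2).1) ?_)
    rw [linPair_factorMatrix_mul hδ]
    have : ((Qval a b c x : ℤ) : ℝ) ≠ 0 := by exact_mod_cast Qval_ne_zero hnsq hx
    positivity
  have hR : (t : ℝ) ^ 2 - ((b ^ 2 - 4 * a * c : ℤ) : ℝ) * u ^ 2 = 4 := by exact_mod_cast h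
  set δ := √((b ^ 2 - 4 * a * c : ℤ) : ℝ)
  set p := linPair (factorMatrix a b δ) x.1 x.2
  set e := ((t : ℝ) + u * δ) / 2
  have hβ : ((t : ℝ) - u * δ) / 2 = e⁻¹ := by
    refine eq_inv_of_mul_eq_one_right ?_
    linear_combination (1 / 4 : ℝ) * hR - (u : ℝ) ^ 2 / 4 * hδ
  obtain ⟨n, hn1, hn2⟩ := exists_mem_Ico_zpow (div_pos hpos hne) (one_lt_pow₀ he two_ne_zero)
  obtain ⟨g, hg, hg'⟩ := exists_automorph_zpow hδ h (-n)
  refine ⟨g, hg, ?_⟩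
  rw [hg', hβ]
  have he0 : 0 < e := by linarith
  have hen : 0 < e ^ n := by positivity
  rw [le_div_iff₀ hne] at hn1
  rw [div_lt_iff₀ hne, zpow_add_one₀ (by positivity)] at hn2
  have hsq : (e ^ 2) ^ n = e ^ n * e ^ n := by
    rw [sq, mul_zpow]
  rw [hsq] at hn1 hn2
  rw [inv_zpow, zpow_neg, inv_inv]
  refine ⟨by positivity, ?_, ?_⟩
  · change |e ^ n * p.2| ≤ (e ^ n)⁻¹ * p.1
    rw [abs_mul, abs_of_pos hen, ← div_eq_inv_mul, le_div_iff₀ hen]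
    linarith
  · change (e ^ n)⁻¹ * p.1 < e ^ 2 * |e ^ n * p.2|
    rw [abs_mul, abs_of_pos hen, ← div_eq_inv_mul, div_lt_iff₀ hen]
    linarith

/-- The orbits counted by `Psi` are in bijection with the primitive points of a sector. -/
theorem Psi_eq_card {k a b c t u : ℤ} (hk : 0 < k) (hD : 0 < b ^ 2 - 4 * a * c)
    (hnsq : ¬ IsSquare (b ^ 2 - 4 * a * c)) (hprim : Int.gcd a (Int.gcd b c) = 1)
    (ht : 0 < t) (hu : 0 < u) (h : t ^ 2 - (b ^ 2 - 4 * a * c) * u ^ 2 = 4)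
    (hmin : ∀ t' u' : ℤ, 0 < t' → 0 < u' → t' ^ 2 - (b ^ 2 - 4 * a * c) * u' ^ 2 = 4 → u ≤ u')
    {M : Matrix (Fin 2) (Fin 2) ℝ} (hM : M = factorMatrix a b √((b ^ 2 - 4 * a * c : ℤ) : ℝ))
    (s : ℝ) :
    Psi (k * a) (k * b) (k * c) s = Nat.card {x : ℤ × ℤ | x ∈ {x : ℤ × ℤ | linPair M x.1 x.2 ∈
        sectorCone (((t : ℝ) + u * √((b ^ 2 - 4 * a * c : ℤ) : ℝ)) / 2) ∧
      |(linPair M x.1 x.2).1 * (linPair M x.1 x.2).2| ≤ 4 * |(a : ℝ)| / k * s} ∧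
      IsCoprime x.1 x.2} := by
  have hδ : √((b ^ 2 - 4 * a * c : ℤ) : ℝ) ^ 2 = (b ^ 2 - 4 * a * c : ℤ) :=
    Real.sq_sqrt (by exact_mod_cast hD.le)
  have hδ0 : √((b ^ 2 - 4 * a * c : ℤ) : ℝ) ≠ 0 :=
    (Real.sqrt_pos.2 (by exact_mod_cast hD)).ne'
  have ha : a ≠ 0 := by
    rintro rfl
    exact hnsq ⟨b, by ring⟩
  have hdet : M.det ≠ 0 := by
    rw [hM, det_factorMatrix]
    exact neg_ne_zero.2 (by positivity)
  have hval : ∀ x : ℤ × ℤ, |(linPair M x.1 x.2).1 * (linPair M x.1 x.2).2| ≤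
      4 * |(a : ℝ)| / k * s ↔
      ((|Qval (k * a) (k * b) (k * c) x| : ℤ) : ℝ) ≤ s := by
    intro x
    have hk' : (0 : ℝ) < k := by exact_mod_cast hk
    have ha' : 0 < |(a : ℝ)| := abs_pos.2 (by exact_mod_cast ha)
    have hQ : Qval (k * a) (k * b) (k * c) x = k * Qval a b c x := by
      simp only [Qval]
      ring
    rw [hM, linPair_factorMatrix_mul hδ, hQ]
    push_cast
    rw [abs_mul, abs_mul, abs_mul, abs_of_pos hk', abs_of_pos (four_pos : (0 : ℝ) < 4),
      div_mul_eq_mul_div, le_div_iff₀ hk']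
    rw [show 4 * |(a : ℝ)| * |((Qval a b c x : ℤ) : ℝ)| * k =
      4 * |(a : ℝ)| * (k * |((Qval a b c x : ℤ) : ℝ)|) by ring]
    exact mul_le_mul_iff_right₀ (by positivity)
  have hgrp := automorphGroup_mul_left hk.ne' a b c
  unfold Psi
  set r := fun x y :
      {x : ℤ × ℤ // IsCoprime x.1 x.2 ∧ ((|Qval (k * a) (k * b) (k * c) x| : ℤ) : ℝ) ≤ s} =>
    ∃ g : SL2Z, formComp (k * a) (k * b) (k * c) g = (k * a, k * b, k * c) ∧
      (y : ℤ × ℤ) = actPair g (x : ℤ × ℤ) with hr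
  have hequiv : Equivalence r := by
    refine ⟨fun x => ⟨1, formComp_one _ _ _, (actPair_one _).symm⟩, ?_, ?_⟩
    · rintro x y ⟨g, hg, hxy⟩
      refine ⟨g⁻¹, (automorphGroup (k * a) (k * b) (k * c)).inv_mem hg, ?_⟩
      rw [hxy, ← actPair_mul, inv_mul_cancel, actPair_one]
    · rintro x y z ⟨g, hg, hxy⟩ ⟨g', hg', hyz⟩
      refine ⟨g' * g, (automorphGroup (k * a) (k * b) (k * c)).mul_mem hg' hg, ?_⟩
      rw [hyz, hxy, actPair_mul]
  symm
  refine Nat.card_congr (Equiv.ofBijective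
    (fun x => Quot.mk r ⟨x.1, x.2.2, (hval _).1 x.2.1.2⟩) ⟨?_, ?_⟩)
  · rintro ⟨x, ⟨hx, hxs⟩, hxc⟩ ⟨y, ⟨hy, hys⟩, hyc⟩ hxy
    obtain ⟨g, hg, hgy⟩ := hequiv.eqvGen_iff.1 (Quot.eqvGen_exact hxy)
    have hg' : g ∈ automorphGroup a b c := hgrp ▸ hg
    obtain ⟨t', w, htw, hact⟩ := exists_pell_of_automorph ha hprim hδ hg'
    refine Subtype.ext (linPair_injective hdet ?_).symm
    refine eq_of_pell_of_mem_sectorCone hD ht hu h hmin htw hx hy ?_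
    rw [← hM] at hact
    have hgy' : y = actPair g x := hgy
    have hyx := hact x
    rw [← hgy'] at hyx
    exact hyx
  · rintro ⟨x, hxc, hxs⟩
    have hx0 : x ≠ 0 := by
      rintro rfl
      exact not_isCoprime_zero_zero hxc
    obtain ⟨g, hg, hgx⟩ := exists_automorph_mem_sectorCone hD hnsq ht hu h hx0
    have hg' : g ∈ automorphGroup (k * a) (k * b) (k * c) := hgrp ▸ hg
    have hs : ((|Qval (k * a) (k * b) (k * c) (actPair g x)| : ℤ) : ℝ) ≤ s := by
      rw [Qval_actPair, mem_automorphGroup.1 hg']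
      exact hxs
    refine ⟨⟨actPair g x, ⟨hM ▸ hgx, (hval _).2 hs⟩, isCoprime_actPair g hxc⟩, ?_⟩
    refine (Quot.sound ?_).symm
    exact ⟨g, hg', rfl⟩

/-- The asymptotics for a multiple `k (a, b, c)` of a primitive form. -/
theorem tendsto_Psi {k a b c t u : ℤ} (hk : 0 < k) (hD : 0 < b ^ 2 - 4 * a * c)
    (hnsq : ¬ IsSquare (b ^ 2 - 4 * a * c)) (hprim : Int.gcd a (Int.gcd b c) = 1)
    (ht : 0 < t) (hu : 0 < u) (h : t ^ 2 - (b ^ 2 - 4 * a * c) * u ^ 2 = 4)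
    (hmin : ∀ t' u' : ℤ, 0 < t' → 0 < u' → t' ^ 2 - (b ^ 2 - 4 * a * c) * u' ^ 2 = 4 → u ≤ u') :
    Tendsto (fun s : ℝ => (Psi (k * a) (k * b) (k * c) s : ℝ) / s) atTop
      (𝓝 (12 * Real.log (((t : ℝ) + u * √((b ^ 2 - 4 * a * c : ℤ) : ℝ)) / 2) /
        (π ^ 2 * (k * √((b ^ 2 - 4 * a * c : ℤ) : ℝ))))) := by
  have hδ : √((b ^ 2 - 4 * a * c : ℤ) : ℝ) ^ 2 = (b ^ 2 - 4 * a * c : ℤ) :=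
    Real.sq_sqrt (by exact_mod_cast hD.le)
  have hδ0 : 0 < √((b ^ 2 - 4 * a * c : ℤ) : ℝ) := Real.sqrt_pos.2 (by exact_mod_cast hD)
  have ha : a ≠ 0 := by
    rintro rfl
    exact hnsq ⟨b, by ring⟩
  have ha' : 0 < |(a : ℝ)| := abs_pos.2 (by exact_mod_cast ha)
  have hk' : (0 : ℝ) < k := by exact_mod_cast hk
  have he := one_lt_of_pell hD ht hu h
  obtain ⟨M, hM⟩ : ∃ M, M = factorMatrix a b √((b ^ 2 - 4 * a * c : ℤ) : ℝ) := ⟨_, rfl⟩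
  have hdet : |M.det| = 4 * |(a : ℝ)| * √((b ^ 2 - 4 * a * c : ℤ) : ℝ) := by
    rw [hM, det_factorMatrix, abs_neg, abs_mul, abs_mul, abs_of_pos hδ0,
      abs_of_pos (four_pos : (0 : ℝ) < 4)]
  have hdet0 : M.det ≠ 0 := by
    rw [← abs_pos, hdet]
    positivity
  have key := Psi_eq_card hk hD hnsq hprim ht hu h hmin hM
  have hQ : ∀ x : ℤ × ℤ, (linPair M x.1 x.2).1 * (linPair M x.1 x.2).2 =
      4 * a * (Qval a b c x : ℤ) := fun x => by rw [hM, linPair_factorMatrix_mul hδ]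
  generalize √((b ^ 2 - 4 * a * c : ℤ) : ℝ) = δ at *
  generalize ((t : ℝ) + u * δ) / 2 = e at *
  have hcount := tendsto_card_coprime
    (T := fun s => {x : ℤ × ℤ | linPair M x.1 x.2 ∈ sectorCone e ∧
      |(linPair M x.1 x.2).1 * (linPair M x.1 x.2).2| ≤ s})
    (fun s => finite_linPair_mem_sector he hdet0 s)
    (fun s s' hss x hx => ⟨hx.1, hx.2.trans hss⟩) ?_ ?_ ?_
    (tendsto_card_linPair_mem_sector he hdet0)
  · have hc : 0 < 4 * |(a : ℝ)| / k := by positivity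
    have hlim := (hcount.comp (tendsto_id.const_mul_atTop hc)).mul_const (4 * |(a : ℝ)| / k)
    refine (hlim.congr fun s => ?_).trans_eq ?_
    · rw [key]
      simp only [Function.comp_apply, id_eq]
      rw [div_mul_eq_mul_div, mul_comm (Nat.cast _), mul_div_mul_left _ _ hc.ne']
    · congr 1
      rw [hdet]
      field_simp
      ring
  · intro s hs
    refine eq_empty_of_forall_notMem fun x hx => ?_
    obtain ⟨hx1, hx2⟩ := hx
    rw [hQ] at hx2
    have hx0 : x ≠ 0 := by
      rintro rfl
      simpa [linPair] using hx1.1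
    have h1 : (1 : ℝ) ≤ |(Qval a b c x : ℝ)| := by
      exact_mod_cast Int.one_le_abs (Qval_ne_zero hnsq hx0)
    have h2 : (1 : ℝ) ≤ |(a : ℝ)| := by exact_mod_cast Int.one_le_abs ha
    rw [abs_mul, abs_mul, abs_of_pos (four_pos : (0 : ℝ) < 4)] at hx2
    nlinarith
  · intro s hs
    simpa [linPair] using hs.1.1
  · intro d hd s
    have hd' : (0 : ℝ) < d := by exact_mod_cast Nat.pos_of_ne_zero hd
    ext x
    simp only [mem_ofPred_eq]
    push_cast
    rw [smul_linPair, smul_mem_sectorCone hd', le_div_iff₀ (by positivity)]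
    refine and_congr_right fun _ => ?_
    rw [Prod.smul_fst, Prod.smul_snd, smul_eq_mul, smul_eq_mul, mul_mul_mul_comm, abs_mul,
      abs_mul_self, ← sq, mul_comm]

end PrimitivePointCount

/-- Theorem 4.4 of the paper. Let `Q` be an indefinite integral binary quadratic form of
non-square discriminant `D_Q = B² - 4AC`, let `D'` be the quotient of `D_Q` by the square of
the gcd of the coefficients of `Q`, let `(t_Q, u_Q)` be the fundamental solution of the Pell
equation `t² - D' u² = 4`, and `R_Q = log ((t_Q + u_Q √D')/2)`. Then
`Ψ_Q(s) ∼ (12 R_Q / (π² √D_Q)) · s` as `s → +∞`. -/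
theorem stmt12 (A B C : ℤ) (hindef : 0 < B ^ 2 - 4 * A * C)
    (hnsq : ¬ IsSquare (B ^ 2 - 4 * A * C))
    (D' : ℤ) (hD' : B ^ 2 - 4 * A * C = D' * (Int.gcd A (Int.gcd B C) : ℤ) ^ 2)
    (tQ uQ : ℤ) (htQ : 0 < tQ) (huQ : 0 < uQ) (hPell : tQ ^ 2 - D' * uQ ^ 2 = 4)
    (hmin : ∀ t u : ℤ, 0 < t → 0 < u → t ^ 2 - D' * u ^ 2 = 4 → uQ ≤ u) :
    Asymptotics.IsEquivalent Filter.atTop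
      (fun s : ℝ => (Psi A B C s : ℝ))
      (fun s : ℝ =>
        12 * Real.log (((tQ : ℝ) + (uQ : ℝ) * Real.sqrt ((D' : ℝ))) / 2) /
          (π ^ 2 * Real.sqrt ((B ^ 2 - 4 * A * C : ℤ) : ℝ)) * s) := by
  have hg0 : (Int.gcd A (Int.gcd B C) : ℤ) ≠ 0 := by
    intro h0
    rw [h0] at hD'
    simp [hD'] at hindef
  obtain ⟨k, hkdef⟩ : ∃ k : ℤ, k = Int.gcd A (Int.gcd B C) := ⟨_, rfl⟩
  have hk : 0 < k := by omega
  obtain ⟨a, rfl⟩ : k ∣ A := hkdef ▸ Int.gcd_dvd_left _ _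
  have hkBC : k ∣ (Int.gcd B C : ℤ) := hkdef ▸ Int.gcd_dvd_right _ _
  obtain ⟨b, rfl⟩ : k ∣ B := hkBC.trans (Int.gcd_dvd_left _ _)
  obtain ⟨c, rfl⟩ : k ∣ C := hkBC.trans (Int.gcd_dvd_right _ _)
  rw [← hkdef] at hD'
  have hprim : Int.gcd a (Int.gcd b c) = 1 := by
    rw [Int.gcd_mul_left, Nat.cast_mul, Int.natCast_natAbs, abs_of_pos hk, Int.gcd_mul_left,
      Nat.cast_mul, Int.natCast_natAbs, abs_of_pos hk] at hkdef
    exact_mod_cast mul_left_cancel₀ hk.ne' (hkdef.symm.trans (mul_one k).symm)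
  obtain rfl : D' = b ^ 2 - 4 * a * c :=
    mul_right_cancel₀ (pow_ne_zero 2 hk.ne') (by rw [← hD']; ring)
  have hD : 0 < b ^ 2 - 4 * a * c := by
    rw [hD'] at hindef
    exact pos_of_mul_pos_left hindef (sq_nonneg k)
  have hns : ¬ IsSquare (b ^ 2 - 4 * a * c) := fun hsq => hnsq (hD' ▸ hsq.mul (IsSquare.sq k))
  have hsqrt : √(((k * b) ^ 2 - 4 * (k * a) * (k * c) : ℤ) : ℝ) =
      k * √((b ^ 2 - 4 * a * c : ℤ) : ℝ) := by
    rw [hD', mul_comm, Int.cast_mul, Int.cast_pow, Real.sqrt_mul (sq_nonneg _),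
      Real.sqrt_sq (by exact_mod_cast hk.le)]
  have hlim := tendsto_Psi hk hD hns hprim htQ huQ hPell hmin
  have hlog := Real.log_pos (one_lt_of_pell hD htQ huQ hPell)
  have hδ0 : 0 < √((b ^ 2 - 4 * a * c : ℤ) : ℝ) := Real.sqrt_pos.2 (by exact_mod_cast hD)
  have hk' : (0 : ℝ) < k := by exact_mod_cast hk
  rw [hsqrt]
  set κ := 12 * Real.log (((tQ : ℝ) + uQ * √((b ^ 2 - 4 * a * c : ℤ) : ℝ)) / 2) /
    (π ^ 2 * (k * √((b ^ 2 - 4 * a * c : ℤ) : ℝ)))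
  have hκ : 0 < κ := by positivity
  refine Asymptotics.isEquivalent_of_tendsto_one ?_
  have hdiv := hlim.div_const κ
  rw [div_self hκ.ne'] at hdiv
  refine hdiv.congr fun s => ?_
  simp only [Pi.div_apply]
  rw [div_div, mul_comm s]
end
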